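/- arXiv:1312.0274 — 3 statements merged into one kernel-verified Lean document; each statement's English description precedes it below -/
import Mathlib

section
/- No Hamiltonian graph on n ≥ 25 vertices consisting of a Hamiltonian cycle plus at most 4 chords is pancyclic. -/
open SimpleGraph

/-- `G` has a cycle of length `k`. -/
def HasCycleLength {V : Type*} (G : SimpleGraph V) (k : ℕ) : Prop :=
  ∃ (v : V) (w : G.Walk v v), w.IsCycle ∧ w.length = k

/-- A graph on a finite vertex type is pancyclic if it has a cycle of every
length `k` with `3 ≤ k ≤ n`, where `n` is the number of vertices. -/
def Pancyclic {V : Type*} [Fintype V] (G : SimpleGraph V) : Prop :=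
  ∀ k : ℕ, 3 ≤ k → k ≤ Fintype.card V → HasCycleLength G k

/-- `m n` is the minimum number of edges of a pancyclic graph on `n` vertices. -/
noncomputable def m (n : ℕ) : ℕ :=
  sInf {e | ∃ G : SimpleGraph (Fin n), Pancyclic G ∧ G.edgeSet.ncard = e}

/-- The set of cycles of `G`, each cycle identified with its edge set. -/
def cycleSets {V : Type*} (G : SimpleGraph V) : Set (Set (Sym2 V)) :=
  {s | ∃ (v : V) (w : G.Walk v v), w.IsCycle ∧ s = {e | e ∈ w.edges}}

/-- The bit of `m` at position `j`, in a form that the kernel evaluates quickly. -/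
def bitOn (m j : ℕ) : Bool := Nat.beq (Nat.land (Nat.shiftRight m j) 1) 1

/-- Eight arcs of unknown lengths are numbered `0, …, 7`, and a natural number `x` stands for the
length form `x / 256 + ∑ A j`, summed over the bits `j < 8` of `x`. This substitutes `A j = v`. -/
def setArc (j v x : ℕ) : ℕ :=
  bif bitOn x j then Nat.add (Nat.xor x (Nat.pow 2 j)) (Nat.mul 256 v) else x

/-- Disposes of the forms in a list that involve no arc of `u` or all of them (of total length `R`):
each must hit a length of the bit set `miss` or use up one unit of `slack`. The remaining forms are
accumulated and handed to the continuation `k`. -/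
def classify (u R : ℕ) (k : ℕ → ℕ → List ℕ → Bool) : List ℕ → ℕ → ℕ → List ℕ → Bool
  | [], miss, slack, und => k miss slack und
  | x :: F, miss, slack, und =>
    let settled (v : ℕ) : Bool :=
      bif bitOn miss v then classify u R k F (Nat.xor miss (Nat.pow 2 v)) slack und
      else bif Nat.beq slack 0 then true else classify u R k F miss (Nat.pred slack) und
    bif Nat.beq (Nat.land x 255) 0 then settled (Nat.shiftRight x 8)
    else bif Nat.beq (Nat.land x 255) u then settled (Nat.add (Nat.shiftRight x 8) R)
    else classify u R k F miss slack (x :: und)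

/-- `f` holds on `{1, …, n}`. -/
def allUpTo (f : ℕ → Bool) : ℕ → Bool
  | 0 => true
  | v + 1 => f (v + 1) && allUpTo f v

/-- Runs the continuation `k` over all assignments of positive lengths with sum `r` to the arcs in
`m`; `u` is the set of arcs whose lengths are still unknown and `R` is their total length. -/
def assign (k : ℕ → ℕ → List ℕ → Bool) : ℕ → ℕ → ℕ → ℕ → ℕ → List ℕ → Bool
  | 0, _, _, _, _, _ => false
  | f + 1, m, r, u, R, F =>
    bif Nat.beq m 0 then (bif Nat.beq r 0 then k u R F else true) else
    let j := Nat.log2 m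
    let next (v : ℕ) : Bool :=
      bif Nat.ble v R then
        assign k f (Nat.xor m (Nat.pow 2 j)) (Nat.sub r v) (Nat.xor u (Nat.pow 2 j)) (Nat.sub R v)
          (F.map (setArc j v))
      else true
    bif Nat.beq m (Nat.pow 2 j) then (bif Nat.beq r 0 then true else next r)
    else allUpTo next (Nat.pred r)

/-- Exhausts the positive lengths, with sum `R`, of the arcs in `u` for which the forms in the list
attain all lengths in `miss` with `slack` forms to spare, branching on the form that attains the
least length still missing. The value `true` means that there are none. -/
def search : ℕ → ℕ → ℕ → ℕ → ℕ → List ℕ → Bool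
  | 0, _, _, _, _, _ => false
  | f + 1, u, R, miss, slack, F =>
    bif Nat.beq u 0 && !Nat.beq R 0 then true else
    classify u R (fun miss slack und =>
      let l := Nat.log2 (Nat.xor miss (Nat.land miss (Nat.pred miss)))
      bitOn miss l && und.all fun x =>
        bif Nat.ble (Nat.shiftRight x 8) l then
          assign (fun u R F => search f u R miss slack F) 9 (Nat.land x 255)
            (Nat.sub l (Nat.shiftRight x 8)) u R und
        else true) F miss slack []

/-- No positive lengths of the arcs in `s`, of total `n ≥ 25`, let the forms in `F` attain all of
`3, …, n`. -/
def excludes (s : ℕ) (F : List ℕ) : Bool :=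
  (List.range (F.length - 22)).all fun i =>
    search 9 s (25 + i) (2 ^ (26 + i) - 8) (F.length - (23 + i)) F

theorem bitOn_eq_testBit (m j : ℕ) : bitOn m j = m.testBit j := by
  have h : Nat.land (Nat.shiftRight m j) 1 = (m >>> j) % 2 := Nat.and_one_is_mod _
  rw [Nat.testBit_eq_decide_div_mod_eq, bitOn, h, Nat.shiftRight_eq_div_pow]
  rw [Bool.eq_iff_iff]
  simp

/-- The total length of the arcs in `m`. -/
def arcSum (A : ℕ → ℕ) (m : ℕ) : ℕ := ∑ j ∈ Finset.range 8, if m.testBit j then A j else 0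

/-- The length expressed by the form `x` under the arc lengths `A`. -/
def value (A : ℕ → ℕ) (x : ℕ) : ℕ := x / 256 + arcSum A x

theorem arcSum_congr {A : ℕ → ℕ} {m m' : ℕ} (h : ∀ j < 8, m.testBit j = m'.testBit j) :
    arcSum A m = arcSum A m' :=
  Finset.sum_congr rfl fun j hj => by rw [h j (Finset.mem_range.1 hj)]

theorem testBit_mod_256 {m j : ℕ} (hj : j < 8) : (m % 256).testBit j = m.testBit j := by
  rw [show 256 = 2 ^ 8 from rfl, Nat.testBit_mod_two_pow]; simp [hj]

theorem land_255_eq_mod (m : ℕ) : Nat.land m 255 = m % 256 := Nat.and_two_pow_sub_one_eq_mod m 8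

theorem testBit_land_255 {m j : ℕ} (hj : j < 8) : (Nat.land m 255).testBit j = m.testBit j := by
  rw [land_255_eq_mod, testBit_mod_256 hj]

theorem arcSum_land_255 (A : ℕ → ℕ) (m : ℕ) : arcSum A (Nat.land m 255) = arcSum A m :=
  arcSum_congr fun _ hj => testBit_land_255 hj

theorem shiftRight_8 (x : ℕ) : Nat.shiftRight x 8 = x / 256 := Nat.shiftRight_eq_div_pow x 8

theorem arcSum_zero (A : ℕ → ℕ) : arcSum A 0 = 0 := by simp [arcSum]

theorem arcSum_xor {A : ℕ → ℕ} {m j : ℕ} (hj : j < 8) (h : m.testBit j) :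
    arcSum A m = A j + arcSum A (Nat.xor m (2 ^ j)) := by
  unfold arcSum
  rw [← Finset.add_sum_erase _ _ (Finset.mem_range.2 hj),
    ← Finset.add_sum_erase (a := j) (f := fun i => if (Nat.xor m (2 ^ j)).testBit i then A i else 0)
      _ (Finset.mem_range.2 hj)]
  have h1 : (Nat.xor m (2 ^ j)).testBit j = false := by
    change (m ^^^ 2 ^ j).testBit j = false
    rw [Nat.testBit_xor]; simp [h]
  simp only [h, h1, if_true, Bool.false_eq_true, if_false, zero_add]
  congr 1
  refine Finset.sum_congr rfl fun i hi => ?_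
  have : (Nat.xor m (2 ^ j)).testBit i = m.testBit i := by
    change (m ^^^ 2 ^ j).testBit i = _
    rw [Nat.testBit_xor, Nat.testBit_two_pow_of_ne (Finset.ne_of_mem_erase hi).symm, Bool.xor_false]
  rw [this]

theorem testBit_xor_two_pow (m i j : ℕ) :
    (Nat.xor m (2 ^ j)).testBit i = (m.testBit i ^^ decide (j = i)) := by
  change (m ^^^ 2 ^ j).testBit i = _
  rw [Nat.testBit_xor, Nat.testBit_two_pow]

/-- The arcs in `x` are among those in `u`. -/
def ArcsIn (u x : ℕ) : Prop := ∀ j < 8, x.testBit j → u.testBit j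

theorem setArc_low {j v x i : ℕ} (hi : i < 8) :
    (setArc j v x).testBit i = (x.testBit i && !decide (j = i)) := by
  unfold setArc
  rw [bitOn_eq_testBit]
  cases h : x.testBit j
  · by_cases hji : j = i
    · subst hji; simp [h]
    · simp [hji]
  · change (Nat.xor x (2 ^ j) + 256 * v).testBit i = _
    rw [← testBit_mod_256 hi, Nat.add_mul_mod_self_left, testBit_mod_256 hi, testBit_xor_two_pow]
    by_cases hji : j = i
    · subst hji; simp [h]
    · simp [hji]

theorem value_setArc {A : ℕ → ℕ} {j x : ℕ} (hj : j < 8) :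
    value A (setArc j (A j) x) = value A x := by
  cases h : x.testBit j
  · simp [setArc, bitOn_eq_testBit, h]
  · have h1 : setArc j (A j) x = Nat.xor x (2 ^ j) + 256 * A j := by
      simp only [setArc, bitOn_eq_testBit, h, cond_true]; rfl
    have h2 : Nat.xor x (2 ^ j) / 256 = x / 256 := by
      change (x ^^^ 2 ^ j) / 2 ^ 8 = x / 2 ^ 8
      rw [← Nat.shiftRight_eq_div_pow, Nat.shiftRight_xor_distrib,
        Nat.shiftRight_eq_div_pow (2 ^ j),
        Nat.div_eq_of_lt (Nat.pow_lt_pow_right (by norm_num) hj), Nat.xor_zero,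
        Nat.shiftRight_eq_div_pow]
    have h3 : arcSum A (setArc j (A j) x) = arcSum A (Nat.xor x (2 ^ j)) := by
      refine arcSum_congr fun i hi => ?_
      rw [setArc_low hi, testBit_xor_two_pow]
      by_cases hji : j = i
      · subst hji; simp [h]
      · simp [hji]
    rw [value, h3, h1, value, arcSum_xor hj h, Nat.add_mul_div_left _ _ (by norm_num), h2]
    ring

/-- The arcs in `u` have positive lengths with sum `R`, and `F` involves no other arcs. -/
structure Consistent (A : ℕ → ℕ) (u R : ℕ) (F : List ℕ) : Prop where
  lt : u < 256
  sum : arcSum A u = R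
  arcs : ∀ x ∈ F, ArcsIn u x
  pos : ∀ j < 8, u.testBit j → 0 < A j

theorem lt_8_of_testBit {u j : ℕ} (hu : u < 256) (h : u.testBit j) : j < 8 := by
  by_contra hj
  rw [Nat.testBit_lt_two_pow
    (hu.trans_le (Nat.pow_le_pow_right (n := 2) (by norm_num) (not_lt.1 hj)))] at h
  cases h

theorem Consistent.set {A : ℕ → ℕ} {u R j : ℕ} {F : List ℕ} (h : Consistent A u R F)
    (hj : u.testBit j) :
    A j ≤ R ∧ Consistent A (Nat.xor u (2 ^ j)) (R - A j) (F.map (setArc j (A j))) := by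
  have hj8 := lt_8_of_testBit h.lt hj
  have hs := arcSum_xor (A := A) hj8 hj
  rw [h.sum] at hs
  refine ⟨by omega, ?_, by omega, ?_, ?_⟩
  · exact Nat.xor_lt_two_pow (n := 8) h.lt (Nat.pow_lt_pow_right (by norm_num) hj8)
  · intro x hx i hi hxi
    obtain ⟨y, hy, rfl⟩ := List.mem_map.1 hx
    rw [setArc_low hi] at hxi
    rw [testBit_xor_two_pow]
    have := h.arcs y hy i hi
    simp_all
  · intro i hi hui
    rw [testBit_xor_two_pow] at hui
    by_cases hji : j = i
    · subst hji; exact h.pos j hi hj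
    · exact h.pos i hi (by simpa [hji] using hui)

theorem allUpTo_iff {f : ℕ → Bool} {n v : ℕ} (h : allUpTo f n = true) (h1 : 1 ≤ v) (hv : v ≤ n) :
    f v = true := by
  induction n with
  | zero => omega
  | succ n ih =>
    simp only [allUpTo, Bool.and_eq_true] at h
    rcases Nat.lt_or_ge n v with h2 | h2
    · rw [show v = n + 1 by omega]; exact h.1
    · exact ih h.2 h2

theorem beq_iff {a b : ℕ} : Nat.beq a b = true ↔ a = b := iff_of_eq Nat.beq_eq

theorem exists_of_assign {A : ℕ → ℕ} {k : ℕ → ℕ → List ℕ → Bool} {f m r u R : ℕ} {F : List ℕ}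
    (h : assign k f m r u R F = true) (hc : Consistent A u R F) (hm : ArcsIn u m) (hm8 : m < 256)
    (hr : arcSum A m = r) :
    ∃ u' R' F', k u' R' F' = true ∧ Consistent A u' R' F' ∧ F'.map (value A) = F.map (value A) := by
  induction f generalizing m r u R F with
  | zero => simp [assign] at h
  | succ f ih =>
    by_cases hm0 : m = 0
    · subst hm0
      rw [arcSum_zero] at hr
      subst hr
      exact ⟨u, R, F, by simpa [assign] using h, hc, rfl⟩
    have hj := Nat.testBit_log2 hm0
    have hj8 := lt_8_of_testBit hm8 hj
    have hs := arcSum_xor (A := A) hj8 hj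
    have hpos := hc.pos _ hj8 (hm _ hj8 hj)
    obtain ⟨hle, hc'⟩ := hc.set (hm _ hj8 hj)
    have key : ∀ v, v = A (Nat.log2 m) → (bif Nat.ble v R then
        assign k f (Nat.xor m (Nat.pow 2 (Nat.log2 m))) (Nat.sub r v)
          (Nat.xor u (Nat.pow 2 (Nat.log2 m))) (Nat.sub R v)
          (F.map (setArc (Nat.log2 m) v))
      else true) = true → ∃ u' R' F', k u' R' F' = true ∧ Consistent A u' R' F' ∧
        F'.map (value A) = F.map (value A) := by
      rintro v rfl hv
      rw [Nat.ble_eq_true_of_le hle, cond_true] at hv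
      obtain ⟨u', R', F', h1, h2, h3⟩ := ih hv hc' (by
          intro i hi hmi
          change (Nat.xor m (2 ^ _)).testBit i = true at hmi
          change (Nat.xor u (2 ^ _)).testBit i = true
          rw [testBit_xor_two_pow] at hmi ⊢
          have := hm i hi
          by_cases hji : m.log2 = i
          · subst hji; simp [hj] at hmi
          · simp_all)
        (Nat.xor_lt_two_pow (n := 8) hm8 (Nat.pow_lt_pow_right (by norm_num) hj8))
        (by change _ = r - A _; change arcSum A (Nat.xor m (2 ^ _)) = _; omega)
      refine ⟨u', R', F', h1, h2, h3.trans ?_⟩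
      rw [List.map_map]
      exact List.map_congr_left fun x _ => value_setArc hj8
    have hb : Nat.beq m 0 = false := by
      rw [← Bool.not_eq_true, beq_iff]; exact hm0
    simp only [assign, hb, cond_false] at h
    by_cases hp : m = 2 ^ Nat.log2 m
    · have hz : Nat.xor m (2 ^ Nat.log2 m) = 0 := by
        change m ^^^ _ = 0
        rw [← hp, Nat.xor_self]
      rw [hz, arcSum_zero, add_zero] at hs
      have hb1 : Nat.beq m (Nat.pow 2 (Nat.log2 m)) = true := beq_iff.2 hp
      have hb2 : Nat.beq r 0 = false := by
        rw [← Bool.not_eq_true, beq_iff]; omega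
      rw [hb1, cond_true, hb2, cond_false] at h
      exact key r (by omega) h
    · have hb1 : Nat.beq m (Nat.pow 2 (Nat.log2 m)) = false := by
        rw [← Bool.not_eq_true, beq_iff]; exact hp
      rw [hb1, cond_false] at h
      refine key _ rfl (allUpTo_iff h hpos ?_)
      have hz : Nat.xor m (2 ^ Nat.log2 m) ≠ 0 := by
        change m ^^^ _ ≠ 0
        rwa [Ne, Nat.xor_eq_zero_iff]
      have hi := Nat.testBit_log2 hz
      have hx8 : Nat.xor m (2 ^ Nat.log2 m) < 256 :=
        Nat.xor_lt_two_pow (n := 8) hm8 (Nat.pow_lt_pow_right (by norm_num) hj8)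
      have hi8 := lt_8_of_testBit hx8 hi
      have hs' := arcSum_xor (A := A) hi8 hi
      have hmi : m.testBit (Nat.xor m (2 ^ Nat.log2 m)).log2 := by
        rw [testBit_xor_two_pow] at hi
        by_contra hne
        rw [Bool.not_eq_true] at hne
        rw [hne, Bool.false_xor, decide_eq_true_eq] at hi
        have := hi
        rw [← this, hj] at hne
        cases hne
      have := hc.pos _ hi8 (hm _ hi8 hmi)
      change _ ≤ r - 1
      omega

/-- `miss` is the bit set of lengths `M`, all attained in `F`, and `slack` counts the surplus
members of `F`. -/
structure Tracks (A : ℕ → ℕ) (miss slack : ℕ) (M : Finset ℕ) (F : List ℕ) : Prop where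
  bit : ∀ l, miss.testBit l = true ↔ l ∈ M
  cover : ∀ l ∈ M, ∃ x ∈ F, value A x = l
  card : M.card + slack = F.length

theorem Tracks.perm {A : ℕ → ℕ} {miss slack : ℕ} {M : Finset ℕ} {F F' : List ℕ}
    (h : Tracks A miss slack M F) (hF : F.Perm F') : Tracks A miss slack M F' :=
  ⟨h.bit, fun l hl => by simpa only [hF.mem_iff] using h.cover l hl, h.card.trans hF.length_eq⟩

theorem Tracks.of_map_eq {A : ℕ → ℕ} {miss slack : ℕ} {M : Finset ℕ} {F F' : List ℕ}
    (h : Tracks A miss slack M F) (hF : F'.map (value A) = F.map (value A)) :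
    Tracks A miss slack M F' := by
  refine ⟨h.bit, fun l hl => ?_, h.card.trans ?_⟩
  · have := List.mem_map.2 (h.cover l hl)
    rwa [← hF, List.mem_map] at this
  · simpa using (congrArg List.length hF).symm

theorem Tracks.card_le {A : ℕ → ℕ} {M : Finset ℕ} {F : List ℕ}
    (h : ∀ l ∈ M, ∃ x ∈ F, value A x = l) : M.card ≤ F.length := by
  calc M.card ≤ (F.map (value A)).toFinset.card := Finset.card_le_card fun l hl => by
        simpa using h l hl
    _ ≤ (F.map (value A)).length := List.toFinset_card_le _
    _ = F.length := List.length_map _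

theorem Tracks.erase {A : ℕ → ℕ} {miss slack x : ℕ} {M : Finset ℕ} {F : List ℕ}
    (h : Tracks A miss slack M (x :: F)) (hx : miss.testBit (value A x) = true) :
    Tracks A (Nat.xor miss (2 ^ value A x)) slack (M.erase (value A x)) F := by
  have hM := (h.bit _).1 hx
  refine ⟨fun l => ?_, fun l hl => ?_, ?_⟩
  · rw [testBit_xor_two_pow, Finset.mem_erase, ← h.bit]
    by_cases hl : value A x = l
    · subst hl; simp [hx]
    · simp [hl, Ne.symm hl]
  · obtain ⟨hne, hl⟩ := Finset.mem_erase.1 hl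
    obtain ⟨y, hy, rfl⟩ := h.cover l hl
    rcases List.mem_cons.1 hy with rfl | hy
    · exact absurd rfl hne
    · exact ⟨y, hy, rfl⟩
  · have := h.card
    have := Finset.card_pos.2 ⟨_, hM⟩
    rw [Finset.card_erase_of_mem hM]
    simp only [List.length_cons] at *
    omega

theorem Tracks.waste {A : ℕ → ℕ} {miss slack x : ℕ} {M : Finset ℕ} {F : List ℕ}
    (h : Tracks A miss slack M (x :: F)) (hx : miss.testBit (value A x) ≠ true) :
    slack ≠ 0 ∧ Tracks A miss (slack - 1) M F := by
  have hcov : ∀ l ∈ M, ∃ y ∈ F, value A y = l := fun l hl => by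
    obtain ⟨y, hy, rfl⟩ := h.cover l hl
    rcases List.mem_cons.1 hy with rfl | hy
    · exact absurd ((h.bit _).2 hl) hx
    · exact ⟨y, hy, rfl⟩
  have h1 := h.card
  have h2 := Tracks.card_le hcov
  rw [List.length_cons] at h1
  exact ⟨by omega, h.bit, hcov, by omega⟩

theorem Consistent.subset {A : ℕ → ℕ} {u R : ℕ} {F F' : List ℕ} (h : Consistent A u R F)
    (hF : ∀ x ∈ F', x ∈ F) : Consistent A u R F' :=
  ⟨h.lt, h.sum, fun x hx => h.arcs x (hF x hx), h.pos⟩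

theorem exists_of_classify {A : ℕ → ℕ} {k : ℕ → ℕ → List ℕ → Bool} {u R : ℕ} {F : List ℕ}
    {miss slack : ℕ} {und : List ℕ} {M : Finset ℕ}
    (h : classify u R k F miss slack und = true) (hc : Consistent A u R (F ++ und))
    (ht : Tracks A miss slack M (F ++ und)) :
    ∃ miss' slack' und' M', k miss' slack' und' = true ∧ Consistent A u R und' ∧
      Tracks A miss' slack' M' und' := by
  induction F generalizing miss slack und M with
  | nil => exact ⟨miss, slack, und, M, h, hc, ht⟩
  | cons x F ih =>
    rw [List.cons_append] at hc ht
    have hc' : Consistent A u R (F ++ und) := hc.subset fun y hy => List.mem_cons_of_mem _ hy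
    have settled : ∀ v, v = value A x →
        (bif bitOn miss v then classify u R k F (Nat.xor miss (Nat.pow 2 v)) slack und
        else bif Nat.beq slack 0 then true
        else classify u R k F miss (Nat.pred slack) und) = true →
        ∃ miss' slack' und' M', k miss' slack' und' = true ∧ Consistent A u R und' ∧
          Tracks A miss' slack' M' und' := by
      rintro v rfl hv
      rw [bitOn_eq_testBit] at hv
      by_cases hb : miss.testBit (value A x) = true
      · rw [hb, cond_true] at hv
        exact ih hv hc' (ht.erase hb)
      · obtain ⟨hs, ht'⟩ := ht.waste hb
        rw [Bool.not_eq_true] at hb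
        have hs0 : Nat.beq slack 0 = false := by rwa [← Bool.not_eq_true, beq_iff]
        rw [hb, cond_false, hs0, cond_false] at hv
        exact ih hv hc' ht'
    have hx := arcSum_land_255 A x
    simp only [classify] at h
    cases h0 : Nat.beq (Nat.land x 255) 0
    · cases h1 : Nat.beq (Nat.land x 255) u
      · rw [h0, h1, cond_false, cond_false] at h
        have hp : (x :: (F ++ und)).Perm (F ++ x :: und) := List.perm_middle.symm
        exact ih h (hc.subset fun y hy => hp.mem_iff.2 hy) (ht.perm hp)
      · rw [h0, h1, cond_false, cond_true] at h
        refine settled _ ?_ h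
        rw [beq_iff.1 h1, hc.sum] at hx
        rw [shiftRight_8, hx]; rfl
    · rw [h0, cond_true] at h
      refine settled _ ?_ h
      rw [beq_iff.1 h0, arcSum_zero] at hx
      rw [shiftRight_8, value, ← hx, add_zero]

theorem false_of_search {A : ℕ → ℕ} {f u R miss slack : ℕ} {F : List ℕ} {M : Finset ℕ}
    (h : search f u R miss slack F = true) (hc : Consistent A u R F)
    (ht : Tracks A miss slack M F) : False := by
  induction f generalizing u R miss slack F M with
  | zero => simp [search] at h
  | succ f ih =>
    have h0 : (Nat.beq u 0 && !Nat.beq R 0) = false := by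
      rw [← Bool.not_eq_true, Bool.and_eq_true, beq_iff]
      rintro ⟨rfl, hR⟩
      rw [← hc.sum, arcSum_zero] at hR
      cases hR
    simp only [search, h0, cond_false] at h
    obtain ⟨miss', slack', und, M', h, hc', ht'⟩ :=
      exists_of_classify h (by rwa [List.append_nil]) (by rwa [List.append_nil])
    rw [Bool.and_eq_true, bitOn_eq_testBit] at h
    obtain ⟨hl, h⟩ := h
    obtain ⟨x, hx, hxl⟩ := ht'.cover _ ((ht'.bit _).1 hl)
    have h := List.all_eq_true.1 h x hx
    rw [← hxl, shiftRight_8,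
      Nat.ble_eq_true_of_le (show x / 256 ≤ value A x from Nat.le_add_right _ _),
      cond_true] at h
    obtain ⟨u', R', F', h1, h2, h3⟩ := exists_of_assign h hc'
      (fun j hj hb => hc'.arcs x hx j hj (by rwa [testBit_land_255 hj] at hb))
      (by rw [land_255_eq_mod]; exact Nat.mod_lt _ (by norm_num))
      (by rw [arcSum_land_255]; exact (Nat.add_sub_cancel_left (x / 256) _).symm)
    exact ih h1 h2 (ht'.of_map_eq h3)

/-- No positive arc lengths on the support `s` realise all required lengths within `F`. -/
def Refutes (s : ℕ) (F : List ℕ) : Prop :=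
  ∀ A : ℕ → ℕ, (∀ j < 8, s.testBit j = true ↔ A j ≠ 0) → 25 ≤ ∑ j ∈ Finset.range 8, A j →
    ∃ l, 3 ≤ l ∧ l ≤ ∑ j ∈ Finset.range 8, A j ∧ ∀ x ∈ F, value A x ≠ l

theorem arcSum_eq_sum {A : ℕ → ℕ} {s : ℕ} (h : ∀ j < 8, s.testBit j = true ↔ A j ≠ 0) :
    arcSum A s = ∑ j ∈ Finset.range 8, A j := by
  refine Finset.sum_congr rfl fun j hj => ?_
  have := h j (Finset.mem_range.1 hj)
  split_ifs with h1
  · rfl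
  · by_contra h2
    exact h1 (this.2 (Ne.symm h2))

theorem testBit_two_pow_sub_eight {n l : ℕ} (hn : 3 ≤ n) :
    (2 ^ (n + 1) - 8).testBit l = true ↔ l ∈ Finset.Icc 3 n := by
  obtain ⟨k, rfl⟩ := Nat.exists_eq_add_of_le hn
  have : 2 ^ (3 + k + 1) - 8 = 2 ^ 3 * (2 ^ (k + 1) - 1) := by
    rw [Nat.mul_sub, ← pow_add]; norm_num [add_assoc]
  rw [this, Nat.testBit_two_pow_mul, Nat.testBit_two_pow_sub_one, Finset.mem_Icc]
  simp; omega

theorem refutes_of_excludes {s : ℕ} {F : List ℕ} (h : excludes s F = true) (hs : s < 256)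
    (hF : ∀ x ∈ F, ArcsIn s x) : Refutes s F := by
  intro A hA hn
  by_contra! hcon
  set n := ∑ j ∈ Finset.range 8, A j with hndef
  have hcov : ∀ l ∈ Finset.Icc 3 n, ∃ x ∈ F, value A x = l :=
    fun l hl => hcon l (Finset.mem_Icc.1 hl).1 (Finset.mem_Icc.1 hl).2
  have hcard := Tracks.card_le hcov
  rw [Nat.card_Icc] at hcard
  obtain ⟨i, hi⟩ := Nat.exists_eq_add_of_le hn
  have h := List.all_eq_true.1 h i (List.mem_range.2 (by omega))
  refine false_of_search (A := A) (M := Finset.Icc 3 n) h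
    ⟨hs, by rw [arcSum_eq_sum hA, ← hi], hF, fun j hj hb => Nat.pos_of_ne_zero ((hA j hj).1 hb)⟩
    ⟨fun l => ?_, hcov, ?_⟩
  · rw [← testBit_two_pow_sub_eight (by omega), hi, show 25 + i + 1 = 26 + i by omega]
  · rw [Nat.card_Icc]; omega

/-- Sets of arcs with lists of length forms, to which every case that is not settled by counting
reduces up to rotation, reflection and passing to a sublist. -/
def reps : List (ℕ × List ℕ) :=
  [ (255, [255, 263, 286, 316, 368, 399, 451, 481, 504, 537, 546, 571, 588, 622, 648, 657, 691,
      708, 733, 742, 805, 843, 850, 873, 918, 941, 948, 986, 1109]),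
    (255, [255, 271, 286, 316, 376, 391, 451, 481, 496, 529, 546, 563, 580, 614, 631, 648, 665,
      699, 716, 733, 750, 813, 843, 858, 873, 918, 933, 948, 978]),
    (255, [255, 259, 286, 312, 368, 399, 455, 481, 508, 541, 550, 584, 622, 652, 657, 695, 708,
      729, 738, 805, 854, 877, 914, 937, 948, 986, 1109, 1194]),
    (255, [255, 263, 284, 318, 368, 399, 449, 483, 504, 539, 546, 569, 590, 620, 648, 659, 689,
      710, 740, 805, 841, 850, 875, 916, 941, 950, 986, 1109]),
    (255, [255, 259, 270, 312, 352, 415, 455, 497, 508, 525, 566, 600, 657, 668, 679, 708, 713,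
      754, 821, 854, 914, 932, 937, 970, 1109, 1194]),
    (255, [255, 259, 286, 304, 376, 391, 463, 481, 508, 541, 558, 584, 614, 644, 665, 716, 721,
      738, 813, 854, 869, 922, 937, 978, 1109, 1194]),
    (255, [255, 257, 284, 312, 368, 399, 455, 483, 510, 548, 584, 620, 654, 659, 695, 710, 731,
      738, 852, 914, 939, 950, 986, 1194]),
    (255, [255, 257, 268, 312, 352, 415, 455, 499, 510, 564, 600, 659, 670, 679, 710, 715, 754,
      852, 914, 934, 939, 970, 1194]),
    (127, [127, 259, 271, 286, 312, 327, 353, 368, 380, 524, 529, 541, 550, 567, 580, 584, 601,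
      610, 622, 786, 805, 809, 820, 854, 858, 1066]),
    (127, [127, 263, 271, 286, 316, 323, 353, 368, 376, 520, 529, 537, 546, 563, 571, 580, 588,
      605, 614, 622, 790, 805, 813, 820, 850, 858]),
    (127, [127, 259, 270, 287, 312, 327, 352, 369, 380, 525, 529, 540, 551, 566, 580, 585, 600,
      626, 786, 804, 809, 821, 842, 854, 1066]),
    (127, [127, 263, 271, 284, 318, 321, 355, 368, 376, 520, 531, 539, 546, 561, 569, 582, 590,
      612, 620, 788, 805, 813, 822, 850, 858]),
    (127, [127, 257, 271, 284, 312, 327, 355, 368, 382, 526, 531, 548, 567, 582, 584, 603, 610,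
      620, 786, 811, 822, 852, 858, 1066]),
    (127, [127, 259, 263, 286, 304, 335, 353, 376, 380, 516, 537, 541, 558, 584, 588, 593, 610,
      614, 794, 809, 813, 850, 854, 1066]),
    (127, [127, 259, 271, 280, 318, 321, 359, 368, 380, 524, 535, 550, 561, 573, 578, 590, 612,
      616, 788, 805, 809, 818, 854, 1066]),
    (127, [127, 257, 268, 287, 312, 327, 352, 371, 382, 531, 542, 551, 564, 582, 587, 600, 626,
      786, 806, 811, 842, 852, 1066]),
    (95, [95, 263, 270, 284, 287, 320, 323, 337, 344, 515, 521, 529, 530, 536, 539, 580, 589, 598,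
      772, 781, 789, 790, 842, 1034]),
    (111, [111, 263, 270, 271, 300, 323, 352, 353, 360, 513, 520, 521, 546, 547, 555, 580, 588,
      589, 614, 774, 804, 805, 834, 842]),
    (119, [119, 263, 263, 278, 308, 323, 353, 368, 368, 512, 529, 529, 546, 563, 563, 580, 580,
      597, 614, 614, 805, 805, 850, 850]),
    (95, [95, 259, 270, 280, 287, 320, 327, 337, 348, 519, 525, 529, 534, 540, 580, 585, 594, 772,
      777, 786, 789, 842, 1034]),
    (95, [95, 259, 271, 280, 286, 321, 327, 336, 348, 518, 524, 529, 535, 541, 578, 580, 584, 590,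
      773, 777, 786, 788, 1034]),
    (95, [95, 263, 271, 284, 286, 321, 323, 336, 344, 514, 520, 529, 531, 537, 539, 580, 582, 588,
      590, 773, 781, 788, 790]),
    (111, [111, 259, 270, 271, 296, 327, 352, 353, 364, 513, 524, 525, 550, 551, 580, 584, 585,
      610, 770, 804, 805, 838, 842]),
    (119, [119, 259, 263, 278, 304, 327, 353, 368, 372, 516, 529, 533, 550, 576, 580, 593, 610,
      614, 786, 801, 805, 850, 1058]),
    (119, [119, 263, 263, 276, 310, 321, 355, 368, 368, 512, 531, 531, 546, 561, 561, 582, 582,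
      612, 612, 805, 805, 850, 850])]

/-- Renames each arc `j` as `j + 1` modulo eight. -/
def rotArcs (x : ℕ) : ℕ :=
  256 * (x / 256) + (2 * (x % 128) + x % 256 / 128)

/-- Renames each arc `j` as `-j` modulo eight. -/
def reflArcs (x : ℕ) : ℕ :=
  256 * (x / 256) + (x % 2 + 2 * (x / 128 % 2) + 4 * (x / 64 % 2) + 8 * (x / 32 % 2) +
    16 * (x / 16 % 2) + 32 * (x / 8 % 2) + 64 * (x / 4 % 2) + 128 * (x / 2 % 2))

/-- `F` is contained in a list of `reps` with set of arcs `s`. -/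
def isRep (s : ℕ) (F : List ℕ) : Bool :=
  reps.any fun r => Nat.beq r.1 s && F.all fun x => r.2.any (Nat.beq x)

/-- One of the first `k` rotations of `(s, F)` satisfies `isRep`. -/
def rotRep : ℕ → ℕ → List ℕ → Bool
  | 0, _, _ => false
  | k + 1, s, F => isRep s F || rotRep k (rotArcs s) (F.map rotArcs)

/-- A rotation or a reflection of `(s, F)` satisfies `isRep`. -/
def covered (s : ℕ) (F : List ℕ) : Bool :=
  rotRep 8 s F || rotRep 8 (reflArcs s) (F.map reflArcs)

set_option maxRecDepth 100000 in
theorem excludes_reps : reps.all (fun r => excludes r.1 r.2) = true := by decide +kernel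

set_option maxRecDepth 100000 in
theorem reps_arcs : reps.all (fun r => Nat.blt r.1 256 &&
    r.2.all fun x => Nat.beq (Nat.land (Nat.land x 255) r.1) (Nat.land x 255)) = true := by
  decide +kernel

theorem Refutes.mono {s : ℕ} {F F' : List ℕ} (h : Refutes s F) (hF : ∀ x ∈ F', x ∈ F) :
    Refutes s F' := fun A hA hn =>
  let ⟨l, h1, h2, h3⟩ := h A hA hn
  ⟨l, h1, h2, fun x hx => h3 x (hF x hx)⟩

theorem refutes_of_isRep {s : ℕ} {F : List ℕ} (h : isRep s F = true) : Refutes s F := by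
  obtain ⟨r, hr, h⟩ := List.any_eq_true.1 h
  rw [Bool.and_eq_true, beq_iff] at h
  obtain ⟨rfl, hF⟩ := h
  have h1 := List.all_eq_true.1 reps_arcs r hr
  rw [Bool.and_eq_true] at h1
  refine (refutes_of_excludes (List.all_eq_true.1 excludes_reps r hr) (by simpa using h1.1)
    fun x hx j hj hb => ?_).mono fun x hx => ?_
  · have h2 := beq_iff.1 (List.all_eq_true.1 h1.2 x hx)
    rw [← testBit_land_255 hj, ← h2] at hb
    change (Nat.land x 255 &&& r.1).testBit j = true at hb
    rw [Nat.testBit_and, Bool.and_eq_true] at hb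
    exact hb.2
  · obtain ⟨y, hy, hxy⟩ := List.any_eq_true.1 (List.all_eq_true.1 hF x hx)
    rwa [beq_iff.1 hxy]

/-- `T` permutes the low eight bits by `ρ`. -/
structure PermutesArcs (T ρ : ℕ → ℕ) : Prop where
  lt : ∀ j < 8, ρ j < 8
  inj : ∀ i < 8, ∀ j < 8, ρ i = ρ j → i = j
  high : ∀ x, T x / 256 = x / 256
  low : ∀ x, ∀ j < 8, (T x).testBit j = x.testBit (ρ j)

theorem PermutesArcs.sum {T ρ : ℕ → ℕ} (h : PermutesArcs T ρ) (f : ℕ → ℕ) :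
    ∑ j ∈ Finset.range 8, f (ρ j) = ∑ j ∈ Finset.range 8, f j := by
  have hinj : Set.InjOn ρ (Finset.range 8) := fun i hi j hj =>
    h.inj i (by simpa using hi) j (by simpa using hj)
  rw [← Finset.sum_image (f := f) hinj]
  congr 1
  refine Finset.eq_of_subset_of_card_le (fun j hj => ?_) (Finset.card_image_of_injOn hinj).ge
  obtain ⟨i, hi, rfl⟩ := Finset.mem_image.1 hj
  exact Finset.mem_range.2 (h.lt i (Finset.mem_range.1 hi))

theorem PermutesArcs.value {T ρ : ℕ → ℕ} (h : PermutesArcs T ρ) (A : ℕ → ℕ) (x : ℕ) :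
    value (fun j => A (ρ j)) (T x) = value A x := by
  rw [_root_.value, _root_.value, h.high]
  congr 1
  rw [arcSum, arcSum, ← h.sum fun j => if x.testBit j then A j else 0]
  exact Finset.sum_congr rfl fun j hj => by rw [h.low x j (Finset.mem_range.1 hj)]

theorem PermutesArcs.refutes {T ρ : ℕ → ℕ} (h : PermutesArcs T ρ) {s : ℕ} {F : List ℕ}
    (hF : Refutes (T s) (F.map T)) : Refutes s F := by
  intro A hA hn
  have hs := h.sum A
  obtain ⟨l, h1, h2, h3⟩ := hF (fun j => A (ρ j))
    (fun j hj => by rw [h.low s j hj]; exact hA _ (h.lt j hj)) (hs.symm ▸ hn)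
  exact ⟨l, h1, hs ▸ h2, fun x hx => by
    rw [← h.value]; exact h3 _ (List.mem_map_of_mem hx)⟩

theorem permutesArcs_rotArcs : PermutesArcs rotArcs fun j => (j + 7) % 8 where
  lt j _ := Nat.mod_lt _ (by norm_num)
  inj := by decide
  high x := by unfold rotArcs; omega
  low x j hj := by
    have key : ∀ y < 256, ∀ j < 8, (rotArcs y).testBit j = y.testBit ((j + 7) % 8) := by
      decide +kernel
    rw [← testBit_mod_256 hj, ← testBit_mod_256 (Nat.mod_lt _ (by norm_num)),
      ← key _ (Nat.mod_lt _ (by norm_num)) j hj]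
    have h1 : x % 256 % 128 = x % 128 := by omega
    have h2 : x % 256 / 256 = 0 := by omega
    simp only [rotArcs, h1, h2, Nat.mod_mod]
    congr 1
    omega

theorem permutesArcs_reflArcs : PermutesArcs reflArcs fun j => (8 - j) % 8 where
  lt j _ := Nat.mod_lt _ (by norm_num)
  inj := by decide
  high x := by unfold reflArcs; omega
  low x j hj := by
    have key : ∀ y < 256, ∀ j < 8, (reflArcs y).testBit j = y.testBit ((8 - j) % 8) := by
      decide +kernel
    rw [← testBit_mod_256 hj, ← testBit_mod_256 (Nat.mod_lt _ (by norm_num)),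
      ← key _ (Nat.mod_lt _ (by norm_num)) j hj]
    have h1 : x % 256 / 128 % 2 = x / 128 % 2 := by omega
    have h2 : x % 256 / 64 % 2 = x / 64 % 2 := by omega
    have h3 : x % 256 / 32 % 2 = x / 32 % 2 := by omega
    have h4 : x % 256 / 16 % 2 = x / 16 % 2 := by omega
    have h5 : x % 256 / 8 % 2 = x / 8 % 2 := by omega
    have h6 : x % 256 / 4 % 2 = x / 4 % 2 := by omega
    have h7 : x % 256 / 2 % 2 = x / 2 % 2 := by omega
    have h8 : x % 256 % 2 = x % 2 := by omega
    have h9 : x % 256 / 256 = 0 := by omega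
    simp only [reflArcs, h1, h2, h3, h4, h5, h6, h7, h8, h9]
    congr 1
    omega

theorem refutes_of_rotRep {k s : ℕ} {F : List ℕ} (h : rotRep k s F = true) : Refutes s F := by
  induction k generalizing s F with
  | zero => simp [rotRep] at h
  | succ k ih =>
    rw [rotRep, Bool.or_eq_true] at h
    exact h.elim refutes_of_isRep fun h => permutesArcs_rotArcs.refutes (ih h)

theorem refutes_of_covered {s : ℕ} {F : List ℕ} (h : covered s F = true) : Refutes s F := by
  rw [covered, Bool.or_eq_true] at h
  exact h.elim refutes_of_rotRep fun h => permutesArcs_reflArcs.refutes (refutes_of_rotRep h)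

/-- Eight chord ends are read off around the cycle as a word in the letters `0, …, 3`. The chord `c`
is encoded by bit `8 + c` and by the arcs on one of its sides. -/
def chordGen (c : ℕ) : ℕ → List ℕ → ℕ
  | _, [] => 2 ^ (8 + c)
  | i, a :: l =>
    bif Nat.beq a c then Nat.xor (2 ^ (i + 1) - 1) (chordGen c (i + 1) l) else chordGen c (i + 1) l

/-- The even subgraph with index `v`: bits `0, …, 3` of `v` select chords, and bit `4` complements
the set of arcs. -/
def codeword (l : List ℕ) (v : ℕ) : ℕ :=
  Nat.xor (bif bitOn v 4 then 255 else 0) <|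
  Nat.xor (bif bitOn v 0 then chordGen 0 0 l else 0) <|
  Nat.xor (bif bitOn v 1 then chordGen 1 0 l else 0) <|
  Nat.xor (bif bitOn v 2 then chordGen 2 0 l else 0)
    (bif bitOn v 3 then chordGen 3 0 l else 0)

/-- The nonempty even subgraphs of the cycle with chords encoded by the word `l`. -/
def code (l : List ℕ) : List ℕ := (List.range 31).map fun v => codeword l (v + 1)

/-- For each other member of `C` with no chord outside `x`, the arcs it has outside `x`. The
subgraph `x` is a cycle only if all these sets contain an arc of positive length. -/
def blockers (C : List ℕ) (x : ℕ) : List ℕ :=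
  (C.filter fun y => !Nat.beq y x &&
    Nat.beq (Nat.lor (Nat.shiftRight y 8) (Nat.shiftRight x 8)) (Nat.shiftRight x 8)).map fun y =>
      Nat.land (Nat.land y 255) (Nat.xor (Nat.land x 255) 255)

/-- All obstructions of `e` meet `s`. -/
def alive (s : ℕ) (e : ℕ × List ℕ) : Bool :=
  e.2.all fun d => !Nat.beq (Nat.land d s) 0

/-- The length form of the subgraph `x`, restricted to the arcs in `s`. -/
def pack (s x : ℕ) : ℕ :=
  Nat.land x s +
    256 * ((bitOn x 8).toNat + (bitOn x 9).toNat + (bitOn x 10).toNat + (bitOn x 11).toNat)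

/-- Checks, for every set of arcs obtained from `s` by removing some of the arcs below `j`, that the
subgraphs in `E` that survive cannot have all the required lengths. -/
def checkSupport : ℕ → ℕ → List (ℕ × List ℕ) → Bool
  | 0, s, E => Nat.blt E.length 23 || covered s (E.map fun e => pack s e.1)
  | j + 1, s, E => Nat.blt E.length 23 || (checkSupport j s E &&
     checkSupport j (Nat.xor s (2 ^ j)) (E.filter (alive (Nat.xor s (2 ^ j)))))

/-- The cycle with chords encoded by `l` misses a length, whatever the lengths of the arcs. -/
def checkWord (l : List ℕ) : Bool :=
  checkSupport 8 255 (((code l).map fun x => (x, blockers (code l) x)).filter (alive 255))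

/-- The letter `c` may follow the word `l`: each letter occurs at most twice, and the first
occurrences appear in increasing order. -/
def okLetter (c : ℕ) (l : List ℕ) : Bool :=
  decide (l.count c < 2) && (c == 0 || l.contains (c - 1))

/-- The words of length `k` encoding the ends of up to four chords. -/
def words : ℕ → List (List ℕ)
  | 0 => [[]]
  | k + 1 => (words k).flatMap fun l => ([0, 1, 2, 3].filter (okLetter · l)).map (l ++ [·])

set_option maxRecDepth 100000 in
theorem checkWord_words : (words 8).all checkWord = true := by decide +kernel

/-- The number of chords in a codeword. -/
def chordCount (x : ℕ) : ℕ :=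
  (x.testBit 8).toNat + (x.testBit 9).toNat + (x.testBit 10).toNat + (x.testBit 11).toNat

theorem value_pack {A : ℕ → ℕ} {s x : ℕ} (hs : s < 256)
    (hA : ∀ j < 8, s.testBit j = true ↔ A j ≠ 0) :
    value A (pack s x) = chordCount x + arcSum A x := by
  have hlt : Nat.land x s < 256 := Nat.and_lt_two_pow (n := 8) x hs
  have hpack : pack s x = Nat.land x s + 256 * chordCount x := by
    simp only [pack, chordCount, bitOn_eq_testBit]
  rw [value, hpack, Nat.add_mul_div_left _ _ (by norm_num), Nat.div_eq_of_lt hlt, zero_add]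
  congr 1
  refine Finset.sum_congr rfl fun j hj => ?_
  have hj := Finset.mem_range.1 hj
  have : (Nat.land x s + 256 * chordCount x).testBit j = (x.testBit j && s.testBit j) := by
    rw [← testBit_mod_256 hj, Nat.add_mul_mod_self_left, testBit_mod_256 hj]
    exact Nat.testBit_and x s j
  rw [this]
  have := hA j hj
  by_cases h0 : A j = 0 <;> simp_all

theorem exists_notMem_of_length_lt {L : List ℕ} {n : ℕ} (hL : L.length < 23) (hn : 25 ≤ n) :
    ∃ l, 3 ≤ l ∧ l ≤ n ∧ l ∉ L := by
  by_contra! h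
  have h1 : (Finset.Icc 3 n).card ≤ L.toFinset.card := Finset.card_le_card fun l hl =>
    List.mem_toFinset.2 (h l (Finset.mem_Icc.1 hl).1 (Finset.mem_Icc.1 hl).2)
  have := L.toFinset_card_le
  rw [Nat.card_Icc] at h1
  omega

/-- Every obstruction of `e` meets the support of `A`. -/
def Survives (A : ℕ → ℕ) (e : ℕ × List ℕ) : Prop :=
  ∀ d ∈ e.2, ∃ i < 8, A i ≠ 0 ∧ d.testBit i = true

theorem Survives.alive {A : ℕ → ℕ} {s : ℕ} {e : ℕ × List ℕ} (h : Survives A e)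
    (hs : ∀ i < 8, A i ≠ 0 → s.testBit i = true) : alive s e = true := by
  refine List.all_eq_true.2 fun d hd => ?_
  obtain ⟨i, hi, hA, hdi⟩ := h d hd
  rw [Bool.not_eq_true', ← Bool.not_eq_true, beq_iff]
  intro h0
  have : (Nat.land d s).testBit i = true := by
    change (d &&& s).testBit i = true
    rw [Nat.testBit_and, hdi, hs i hi hA]; rfl
  rw [h0, Nat.zero_testBit] at this
  cases this

theorem exists_of_length_blt {A : ℕ → ℕ} {E : List (ℕ × List ℕ)}
    (h : Nat.blt E.length 23 = true) (hn : 25 ≤ ∑ i ∈ Finset.range 8, A i) :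
    ∃ l, 3 ≤ l ∧ l ≤ ∑ i ∈ Finset.range 8, A i ∧
      ∀ e ∈ E, Survives A e → chordCount e.1 + arcSum A e.1 ≠ l := by
  obtain ⟨l, h1, h2, h3⟩ := exists_notMem_of_length_lt
    (L := E.map fun e => chordCount e.1 + arcSum A e.1) (by simpa using h) hn
  exact ⟨l, h1, h2, fun e he _ hl => h3 (List.mem_map.2 ⟨e, he, hl⟩)⟩

theorem exists_of_checkSupport {A : ℕ → ℕ} {j s : ℕ} {E : List (ℕ × List ℕ)}
    (h : checkSupport j s E = true) (hs : s < 256) (hA : ∀ i < 8, A i ≠ 0 → s.testBit i = true)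
    (hA' : ∀ i < 8, j ≤ i → s.testBit i = true → A i ≠ 0)
    (hj : j ≤ 8) (hn : 25 ≤ ∑ i ∈ Finset.range 8, A i) :
    ∃ l, 3 ≤ l ∧ l ≤ ∑ i ∈ Finset.range 8, A i ∧
      ∀ e ∈ E, Survives A e → chordCount e.1 + arcSum A e.1 ≠ l := by
  induction j generalizing s E with
  | zero =>
    rw [checkSupport, Bool.or_eq_true] at h
    refine h.elim (exists_of_length_blt · hn) fun h => ?_
    have hA2 : ∀ i < 8, s.testBit i = true ↔ A i ≠ 0 :=
      fun i hi => ⟨hA' i hi (Nat.zero_le _), hA i hi⟩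
    obtain ⟨l, h1, h2, h3⟩ := refutes_of_covered h A hA2 hn
    refine ⟨l, h1, h2, fun e he _ => ?_⟩
    rw [← value_pack hs hA2]
    exact h3 _ (List.mem_map.2 ⟨e, he, rfl⟩)
  | succ j ih =>
    rw [checkSupport, Bool.or_eq_true, Bool.and_eq_true] at h
    refine h.elim (exists_of_length_blt · hn) fun h => ?_
    by_cases h0 : s.testBit j = true ∧ A j = 0
    · have hbit : ∀ i, (Nat.xor s (2 ^ j)).testBit i = (s.testBit i && !decide (j = i)) := by
        intro i
        rw [testBit_xor_two_pow]
        by_cases hi : j = i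
        · subst hi; simp [h0.1]
        · simp [hi]
      have hA2 : ∀ i < 8, A i ≠ 0 → (Nat.xor s (2 ^ j)).testBit i = true := by
        intro i hi hAi
        have : j ≠ i := by rintro rfl; exact hAi h0.2
        rw [hbit, hA i hi hAi]
        simp [this]
      obtain ⟨l, h1, h2, h3⟩ := ih h.2
        (Nat.xor_lt_two_pow (n := 8) hs (Nat.pow_lt_pow_right (by norm_num) hj)) hA2
        (fun i hi hji hsi => by
          rw [hbit, Bool.and_eq_true] at hsi
          refine hA' i hi ?_ hsi.1
          have : j ≠ i := by simpa using hsi.2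
          omega)
        (by omega)
      exact ⟨l, h1, h2, fun e he hse => h3 e (List.mem_filter.2 ⟨he, hse.alive hA2⟩) hse⟩
    · refine ih h.1 hs hA (fun i hi hji hsi => ?_) (by omega)
      rcases hji.eq_or_lt with rfl | hji
      · exact fun hAi => h0 ⟨hsi, hAi⟩
      · exact hA' i hi hji hsi

theorem exists_missing_length {l : List ℕ} (hl : l ∈ words 8) {A : ℕ → ℕ}
    (hn : 25 ≤ ∑ i ∈ Finset.range 8, A i) :
    ∃ k, 3 ≤ k ∧ k ≤ ∑ i ∈ Finset.range 8, A i ∧ ∀ x ∈ code l,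
      (∀ y ∈ code l, y ≠ x → (∀ c, y.testBit (8 + c) = true → x.testBit (8 + c) = true) →
        ∃ j < 8, A j ≠ 0 ∧ y.testBit j = true ∧ x.testBit j = false) →
      chordCount x + arcSum A x ≠ k := by
  have h255 : ∀ i < 8, Nat.testBit 255 i = true := by decide
  obtain ⟨k, h1, h2, h3⟩ := exists_of_checkSupport (A := A)
    (List.all_eq_true.1 checkWord_words l hl) (by norm_num) (fun i hi _ => h255 i hi)
    (fun i hi hi' _ => by omega) le_rfl hn
  refine ⟨k, h1, h2, fun x hx hmin => ?_⟩
  have hsurv : Survives A (x, blockers (code l) x) := by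
    intro d hd
    obtain ⟨y, hy, rfl⟩ := List.mem_map.1 hd
    rw [List.mem_filter, Bool.and_eq_true, Bool.not_eq_true', ← Bool.not_eq_true, beq_iff,
      beq_iff] at hy
    obtain ⟨hy, hne, hsub⟩ := hy
    obtain ⟨j, hj, hAj, hyj, hxj⟩ := hmin y hy hne fun c hc => by
      have h4 : (y >>> 8 ||| x >>> 8).testBit c = (x >>> 8).testBit c :=
        congrArg (fun n : ℕ => n.testBit c) hsub
      rw [Nat.testBit_or, Nat.testBit_shiftRight, Nat.testBit_shiftRight, hc, Bool.true_or] at h4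
      exact h4.symm
    refine ⟨j, hj, hAj, ?_⟩
    change ((y &&& 255) &&& ((x &&& 255) ^^^ 255)).testBit j = true
    simp [Nat.testBit_and, Nat.testBit_xor, hyj, hxj, h255 j hj]
  exact h3 (x, blockers (code l) x) (List.mem_filter.2
    ⟨List.mem_map.2 ⟨x, hx, rfl⟩, hsurv.alive fun i hi _ => h255 i hi⟩) hsurv

/-- A truth value as an element of `ZMod 2`. -/
def bit2 (b : Bool) : ZMod 2 := if b then 1 else 0

theorem bit2_xor (a b : Bool) : bit2 (a ^^ b) = bit2 a + bit2 b := by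
  revert a b; decide

theorem bit2_injective {a b : Bool} (h : bit2 a = bit2 b) : a = b := by
  revert a b; decide

theorem chordGen_low {c i j : ℕ} {l : List ℕ} (hj : j < 8) :
    bit2 ((chordGen c i l).testBit j) = ((l.drop (j - i)).count c : ZMod 2) := by
  induction l generalizing i with
  | nil =>
    rw [chordGen, Nat.testBit_two_pow_of_ne (by omega)]
    simp [bit2]
  | cons a l ih =>
    have hdrop (h : i < j) : (a :: l).drop (j - i) = l.drop (j - (i + 1)) := by
      rw [show j - i = j - (i + 1) + 1 by omega]; simp
    rw [chordGen]
    cases h : Nat.beq a c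
    · rw [cond_false, ih]
      have hac : a ≠ c := by rintro rfl; simp at h
      rcases lt_or_ge i j with hij | hij
      · rw [hdrop hij]
      · rw [show j - i = 0 by omega, show j - (i + 1) = 0 by omega, List.drop_zero, List.drop_zero,
          List.count_cons_of_ne hac]
    · rw [cond_true]
      have hac : a = c := beq_iff.1 h
      change bit2 ((_ ^^^ chordGen c (i + 1) l).testBit j) = _
      rw [Nat.testBit_xor, bit2_xor, ih, Nat.testBit_two_pow_sub_one]
      rcases lt_or_ge i j with hij | hij
      · rw [hdrop hij]
        simp [bit2, show ¬ j < i + 1 by omega]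
      · rw [show j - i = 0 by omega, show j - (i + 1) = 0 by omega, List.drop_zero, List.drop_zero,
          hac, List.count_cons_self]
        simp [bit2, show j < i + 1 by omega, add_comm]

theorem chordGen_high {c i d : ℕ} {l : List ℕ} (hl : i + l.length ≤ 8) :
    (chordGen c i l).testBit (8 + d) = decide (c = d) := by
  induction l generalizing i with
  | nil => rw [chordGen, Nat.testBit_two_pow]; simp
  | cons a l ih =>
    rw [List.length_cons] at hl
    rw [chordGen]
    cases h : Nat.beq a c
    · rw [cond_false, ih (by omega)]
    · rw [cond_true]
      change ((_ ^^^ chordGen c (i + 1) l).testBit (8 + d)) = _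
      rw [Nat.testBit_xor, ih (by omega), Nat.testBit_two_pow_sub_one]
      simp [show ¬ 8 + d < i + 1 by omega]

theorem testBit_natXor (a b i : ℕ) : (Nat.xor a b).testBit i = (a.testBit i ^^ b.testBit i) :=
  Nat.testBit_xor a b i

/-- The index, in the sense of `codeword`, of a set of chords and a complementation flag. -/
def codeIndex (S : Finset (Fin 4)) (t : Bool) : ℕ :=
  (decide (0 ∈ S)).toNat + 2 * (decide (1 ∈ S)).toNat + 4 * (decide (2 ∈ S)).toNat +
    8 * (decide (3 ∈ S)).toNat + 16 * t.toNat

theorem codeIndex_testBit (S : Finset (Fin 4)) (t : Bool) :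
    (codeIndex S t).testBit 0 = decide (0 ∈ S) ∧ (codeIndex S t).testBit 1 = decide (1 ∈ S) ∧
    (codeIndex S t).testBit 2 = decide (2 ∈ S) ∧ (codeIndex S t).testBit 3 = decide (3 ∈ S) ∧
    (codeIndex S t).testBit 4 = t := by
  revert S t; decide +kernel

theorem codeword_low {l : List ℕ} {S : Finset (Fin 4)} {t : Bool} {j : ℕ} (hj : j < 8) :
    bit2 ((codeword l (codeIndex S t)).testBit j) =
      bit2 t + ∑ c ∈ S, ((l.drop j).count (c : ℕ) : ZMod 2) := by
  obtain ⟨h0, h1, h2, h3, h4⟩ := codeIndex_testBit S t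
  have h255 : ∀ i < 8, Nat.testBit 255 i = true := by decide
  have hb : ∀ (b : Bool) (c : ℕ), bit2 ((bif b then chordGen c 0 l else 0).testBit j) =
      if b then ((l.drop j).count c : ZMod 2) else 0 := fun b c => by
    cases b
    · simp [bit2]
    · simpa using chordGen_low (c := c) (i := 0) (l := l) hj
  have ht : bit2 ((bif t then 255 else 0 : ℕ).testBit j) = bit2 t := by
    cases t
    · simp
    · simp [h255 j hj]
  rw [codeword]
  simp only [bitOn_eq_testBit, h0, h1, h2, h3, h4]
  rw [testBit_natXor, testBit_natXor, testBit_natXor, testBit_natXor, bit2_xor, bit2_xor,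
    bit2_xor, bit2_xor, hb, hb, hb, hb, ht]
  have : ∑ c ∈ S, ((l.drop j).count (c : ℕ) : ZMod 2) =
      ∑ c : Fin 4, if c ∈ S then ((l.drop j).count (c : ℕ) : ZMod 2) else 0 := by simp
  rw [this, Fin.sum_univ_four]
  simp
  ring

theorem codeword_high {l : List ℕ} (hl : l.length = 8) {S : Finset (Fin 4)} {t : Bool} (c : Fin 4) :
    (codeword l (codeIndex S t)).testBit (8 + c) = decide (c ∈ S) := by
  obtain ⟨h0, h1, h2, h3, h4⟩ := codeIndex_testBit S t
  have hb : ∀ (b : Bool) (d : ℕ), (bif b then chordGen d 0 l else 0).testBit (8 + c) =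
      (b && decide (d = c)) := fun b d => by
    cases b
    · simp
    · simpa using chordGen_high (c := d) (i := 0) (l := l) (d := c) (by omega)
  have ht : (bif t then 255 else 0 : ℕ).testBit (8 + c) = false := by
    have h255 : ∀ c : Fin 4, Nat.testBit 255 (8 + c) = false := by decide
    cases t <;> simp [h255 c]
  rw [codeword]
  simp only [bitOn_eq_testBit, h0, h1, h2, h3, h4]
  rw [testBit_natXor, testBit_natXor, testBit_natXor, testBit_natXor, hb, hb, hb, hb, ht]
  revert c
  rw [Fin.forall_fin_succ]
  simp [Fin.forall_fin_succ]

theorem chordCount_codeword {l : List ℕ} (hl : l.length = 8) (S : Finset (Fin 4)) (t : Bool) :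
    chordCount (codeword l (codeIndex S t)) = S.card := by
  have h := codeword_high hl (S := S) (t := t)
  have h0 := h 0
  have h1 := h 1
  have h2 := h 2
  have h3 := h 3
  simp only [Fin.isValue, Fin.val_zero, Fin.val_one, Fin.val_two, Nat.reduceAdd,
    show ((3 : Fin 4) : ℕ) = 3 from rfl] at h0 h1 h2 h3
  rw [chordCount, h0, h1, h2, h3]
  clear * -
  revert S; decide

theorem codeword_mem_code {l : List ℕ} {S : Finset (Fin 4)} {t : Bool}
    (h : S.Nonempty ∨ t = true) : codeword l (codeIndex S t) ∈ code l := by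
  have key : ∀ (S : Finset (Fin 4)) (t : Bool), S.Nonempty ∨ t = true →
      ∃ v < 31, codeIndex S t = v + 1 := by decide +kernel
  obtain ⟨v, hv, h⟩ := key S t h
  exact List.mem_map.2 ⟨v, List.mem_range.2 hv, by rw [h]⟩

theorem exists_of_mem_code {l : List ℕ} {y : ℕ} (h : y ∈ code l) :
    ∃ S t, (S.Nonempty ∨ t = true) ∧ y = codeword l (codeIndex S t) := by
  have key : ∀ v < 31, ∃ (S : Finset (Fin 4)) (t : Bool), (S.Nonempty ∨ t = true) ∧
      codeIndex S t = v + 1 := by decide +kernel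
  obtain ⟨v, hv, rfl⟩ := List.mem_map.1 h
  obtain ⟨S, t, hS, h⟩ := key v (List.mem_range.1 hv)
  exact ⟨S, t, hS, by rw [h]⟩

theorem append_mem_words {k c : ℕ} {l : List ℕ} (hl : l ∈ words k) (hc : c < 4)
    (h : okLetter c l = true) : l ++ [c] ∈ words (k + 1) := by
  refine List.mem_flatMap.2 ⟨l, hl, List.mem_map.2 ⟨c, List.mem_filter.2 ⟨?_, h⟩, rfl⟩⟩
  interval_cases c <;> simp

theorem mem_words {l : List ℕ}
    (h : ∀ l₁ c l₂, l = l₁ ++ c :: l₂ → c < 4 ∧ okLetter c l₁ = true) : l ∈ words l.length := by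
  induction l using List.reverseRecOn with
  | nil => simp [words]
  | append_singleton l c ih =>
    rw [List.length_append]
    obtain ⟨h1, h2⟩ := h l c [] rfl
    exact append_mem_words (ih fun l₁ d l₂ hl => h l₁ d (l₂ ++ [c]) (by simp [hl])) h1 h2

theorem drop_countP_of_pairwise {α : Type*} {P : α → Bool} {L : List α}
    (h : L.Pairwise fun a b => P b = true → P a = true) :
    L.drop (L.countP P) = L.filter fun a => !P a := by
  induction L with
  | nil => rfl
  | cons a L ih =>
    obtain ⟨h1, h2⟩ := List.pairwise_cons.1 h
    cases ha : P a
    · have hL : ∀ b ∈ L, P b = false := fun b hb => by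
        rw [← Bool.not_eq_true]; intro hPb; rw [h1 b hb hPb] at ha; cases ha
      have h0 : L.countP P = 0 := List.countP_eq_zero.2 fun b hb => by simp [hL b hb]
      rw [List.countP_cons_of_neg (by simp [ha]), h0, List.drop_zero, List.filter_eq_self.2]
      intro b hb
      rcases List.mem_cons.1 hb with rfl | hb
      · simp [ha]
      · simp [hL b hb]
    · rw [List.countP_cons_of_pos ha, List.drop_succ_cons, ih h2,
        List.filter_cons_of_neg (by simp [ha])]

/-- Reading the eight chord ends around the cycle yields a word of `words 8`. -/
theorem exists_word {p q : Fin 4 → ℕ} (hp : Monotone p) (hpq : ∀ c, p c ≤ q c) :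
    ∃ l ∈ words 8, l.length = 8 ∧ (∀ c : Fin 4, l.count (c : ℕ) = 2) ∧
      ∃ gap : ℕ → ℕ, ∀ i, gap i ≤ 8 ∧ ∀ c : Fin 4, (l.drop (gap i)).count (c : ℕ) =
        (if i < p c then 1 else 0) + if i < q c then 1 else 0 := by
  let f : Fin 8 → ℕ := ![p 0, p 1, p 2, p 3, q 0, q 1, q 2, q 3]
  let g : Fin 8 → ℕ := fun a => 8 * f a + a
  let r : Fin 8 → Fin 8 → Prop := fun a b => g a ≤ g b
  let L : List (Fin 8) := (List.finRange 8).mergeSort fun a b => decide (r a b)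
  let letter : Fin 8 → ℕ := fun a => a % 4
  have hperm : L.Perm (List.finRange 8) := List.mergeSort_perm _ _
  have hlen : L.length = 8 := by rw [hperm.length_eq, List.length_finRange]
  have hpw : L.Pairwise r := by
    have := List.pairwise_mergeSort (le := fun a b => decide (r a b)) (by
      intro a b c hab hbc; simp only [decide_eq_true_eq, r] at *; omega) (by
      intro a b; simp only [Bool.or_eq_true, decide_eq_true_eq, r]; omega) (List.finRange 8)
    simpa using this
  have hmem : ∀ a, a ∈ L := fun a => hperm.mem_iff.2 (List.mem_finRange a)
  have hcountP : ∀ P : Fin 8 → Bool, L.countP P = (List.finRange 8).countP P :=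
    fun P => hperm.countP_eq P
  have hcount : ∀ c : Fin 4, (L.map letter).count (c : ℕ) = 2 := fun c => by
    rw [List.count_eq_countP, List.countP_map, hcountP]
    revert c; decide
  have hfirst : ∀ (a : Fin 8) (c : ℕ) (hc : c + 1 = letter a),
      g ⟨c, by have : letter a < 4 := Nat.mod_lt _ (by norm_num); omega⟩ < g a := by
    have h01 := hp (show (0 : Fin 4) ≤ 1 by decide)
    have h12 := hp (show (1 : Fin 4) ≤ 2 by decide)
    have h23 := hp (show (2 : Fin 4) ≤ 3 by decide)
    have h1 := hpq 1
    have h2 := hpq 2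
    have h3 := hpq 3
    intro a c hc
    fin_cases a <;> simp [letter] at hc <;> subst hc <;> simp [g, f] <;> omega
  refine ⟨L.map letter, ?_, by simpa using hlen, hcount,
    fun i => L.countP fun a => decide (f a ≤ i),
    fun i => ⟨List.countP_le_length.trans hlen.le, fun c => ?_⟩⟩
  · have : L.map letter ∈ words (L.map letter).length := mem_words fun l₁ c l₂ h => ?_
    · rwa [List.length_map, hlen] at this
    obtain ⟨L₁, L₂', hL, rfl, h2⟩ := List.map_eq_append_iff.1 h
    obtain ⟨a, L₂, rfl, rfl, rfl⟩ := List.map_eq_cons_iff.1 h2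
    have hlt : letter a < 4 := Nat.mod_lt _ (by norm_num)
    refine ⟨hlt, ?_⟩
    rw [okLetter, Bool.and_eq_true, decide_eq_true_eq]
    constructor
    · have := hcount ⟨letter a, hlt⟩
      rw [h, List.count_append, List.count_cons_self] at this
      simp only at this
      omega
    · rw [Bool.or_eq_true, beq_iff_eq, List.contains_iff_mem]
      rcases Nat.eq_zero_or_pos (letter a) with h0 | h0
      · exact Or.inl h0
      right
      have hb := hfirst a (letter a - 1) (by omega)
      refine List.mem_map.2 ⟨⟨letter a - 1, by omega⟩, ?_, ?_⟩
      · have h3 := hmem ⟨letter a - 1, by omega⟩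
        rw [hL, List.mem_append] at h3
        refine h3.resolve_right fun h3 => ?_
        rw [hL] at hpw
        rcases List.mem_cons.1 h3 with h4 | h4
        · rw [h4] at hb; exact lt_irrefl _ hb
        · have : g a ≤ _ := (List.pairwise_cons.1 (List.pairwise_append.1 hpw).2.1).1 _ h4
          omega
      · exact Nat.mod_eq_of_lt (show letter a - 1 < 4 by omega)
  · rw [← List.map_drop, drop_countP_of_pairwise (hpw.imp fun {a b} hab hb => ?_),
      List.count_eq_countP, List.countP_map, List.countP_filter, hcountP]
    · have key : ∀ (P : Fin 8 → Bool) (c : Fin 4),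
          (List.finRange 8).countP (fun a => ((· == (c : ℕ)) ∘ letter) a && P a) =
            (P (Fin.castAdd 4 c)).toNat + (P (Fin.natAdd 4 c)).toNat := by
        intro P
        simp [Fin.forall_fin_succ, List.finRange_succ, List.countP_cons, letter, Bool.toNat,
          Bool.cond_eq_ite]
        exact ⟨add_comm _ _, add_comm _ _, add_comm _ _, add_comm _ _⟩
      have h1 : f (Fin.castAdd 4 c) = p c := by fin_cases c <;> rfl
      have h2 : f (Fin.natAdd 4 c) = q c := by fin_cases c <;> rfl
      have h3 (x : ℕ) : (!decide (x ≤ i)).toNat = if i < x then 1 else 0 := by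
        rcases lt_or_ge i x with h | h
        · simp [h]
        · simp [h, not_lt.2 h]
      rw [key, h1, h2, h3, h3]
    · simp only [decide_eq_true_eq, r, g] at *
      omega

/-- Whether the `i`-th edge of the cycle `0, 1, 2, …` lies in the even subgraph with chord set `S`,
where the chord `c` joins `p c` to `q c`. -/
def side (p q : Fin 4 → ℕ) (S : Finset (Fin 4)) (t : Bool) (i : ℕ) : ZMod 2 :=
  bit2 t + ∑ c ∈ S, ((if i < p c then 1 else 0) + if i < q c then 1 else 0)

theorem bit2_eq_one {b : Bool} : bit2 b = 1 ↔ b = true := by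
  revert b; decide

theorem exists_missing_card {n : ℕ} (hn : 25 ≤ n) {p q : Fin 4 → ℕ} (hp : Monotone p)
    (hpq : ∀ c, p c ≤ q c) :
    ∃ k, 3 ≤ k ∧ k ≤ n ∧ ∀ S t, (S.Nonempty ∨ t = true) →
      (∀ S' ⊆ S, ∀ t', (S'.Nonempty ∨ t' = true) →
        (∀ i < n, side p q S' t' i = 1 → side p q S t i = 1) → S' = S ∧ t' = t) →
      S.card + ((Finset.range n).filter fun i => side p q S t i = 1).card ≠ k := by
  obtain ⟨l, hl, hlen, hcount, gap, hgap⟩ := exists_word hp hpq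
  have hdrop (i : ℕ) (c : Fin 4) : ((l.drop (gap i % 8)).count (c : ℕ) : ZMod 2) =
      (if i < p c then 1 else 0) + if i < q c then 1 else 0 := by
    have h : ((l.drop (gap i)).count (c : ℕ) : ZMod 2) =
        (if i < p c then 1 else 0) + if i < q c then 1 else 0 := by
      rw [(hgap i).2 c]; push_cast; rfl
    rw [← h]
    rcases (hgap i).1.lt_or_eq with h8 | h8
    · rw [Nat.mod_eq_of_lt h8]
    · rw [h8, Nat.mod_self, List.drop_zero, hcount, ← hlen, List.drop_length,
        List.count_nil]
      rfl
  have hbit (S : Finset (Fin 4)) (t : Bool) (i : ℕ) :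
      bit2 ((codeword l (codeIndex S t)).testBit (gap i % 8)) = side p q S t i := by
    rw [codeword_low (Nat.mod_lt _ (by norm_num)), side]
    simp only [hdrop]
  let A : ℕ → ℕ := fun j => ∑ i ∈ Finset.range n, if gap i % 8 = j then 1 else 0
  have harc (x : ℕ) : arcSum A x =
      ((Finset.range n).filter fun i => x.testBit (gap i % 8) = true).card := by
    have (j : ℕ) : (if x.testBit j then A j else 0) =
        ∑ i ∈ Finset.range n,
          if gap i % 8 = j then (if x.testBit (gap i % 8) then 1 else 0) else 0 := by
      split_ifs with h
      · refine Finset.sum_congr rfl fun i _ => ?_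
        split_ifs with h1 h2
        · rfl
        · exact absurd (h1 ▸ h) h2
        · rfl
      · symm
        refine Finset.sum_eq_zero fun i _ => ?_
        split_ifs with h1 h2
        · exact absurd (h1 ▸ h2) h
        · rfl
        · rfl
    rw [arcSum]
    simp only [this]
    rw [Finset.sum_comm, Finset.card_filter]
    refine Finset.sum_congr rfl fun i _ => ?_
    rw [Finset.sum_ite_eq, if_pos (Finset.mem_range.2 (Nat.mod_lt _ (by norm_num)))]
  have hA : ∑ j ∈ Finset.range 8, A j = n := by
    simp only [A]
    rw [Finset.sum_comm]
    calc _ = ∑ i ∈ Finset.range n, 1 := Finset.sum_congr rfl fun i _ => by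
          rw [Finset.sum_ite_eq, if_pos (Finset.mem_range.2 (Nat.mod_lt _ (by norm_num)))]
      _ = n := by simp
  obtain ⟨k, h1, h2, h3⟩ := exists_missing_length hl (A := A) (hA.symm ▸ hn)
  refine ⟨k, h1, hA ▸ h2, fun S t hS hmin => ?_⟩
  have h4 := h3 _ (codeword_mem_code hS) fun y hy hne hhigh => ?_
  · rw [chordCount_codeword hlen, harc] at h4
    simpa only [← bit2_eq_one, hbit] using h4
  · obtain ⟨S', t', hS', rfl⟩ := exists_of_mem_code hy
    by_contra! hcon
    refine hne ?_
    obtain ⟨rfl, rfl⟩ := hmin S' (fun c hc => by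
        have := hhigh c (by rw [codeword_high hlen]; simpa using hc)
        rw [codeword_high hlen] at this
        simpa using this) t' hS' fun i hi h5 => by
      rw [← hbit, bit2_eq_one] at h5 ⊢
      have hAi : A (gap i % 8) ≠ 0 := by
        refine (Nat.pos_of_ne_zero ?_).ne'
        intro h0
        have := Finset.sum_eq_zero_iff.1 h0 i (Finset.mem_range.2 hi)
        simp at this
      have := hcon _ (Nat.mod_lt _ (by norm_num)) hAi h5
      simpa using this
    rfl

/-- `u 0, …, u (n - 1)` are the distinct vertices of a closed sequence. -/
structure EnumeratesCycle {V : Type*} (u : ℕ → V) (n : ℕ) : Prop where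
  three_le : 3 ≤ n
  inj : ∀ i < n, ∀ j < n, u i = u j → i = j
  wrap : u n = u 0

theorem SimpleGraph.Walk.IsCycle.enumeratesCycle {V : Type*} {G : SimpleGraph V} {v : V}
    {w : G.Walk v v} (hw : w.IsCycle) : EnumeratesCycle w.getVert w.length where
  three_le := hw.three_le_length
  inj i hi j hj h := hw.getVert_injOn' (show i ≤ w.length - 1 by omega)
    (show j ≤ w.length - 1 by omega) h
  wrap := by simp

/-- `r` precedes `k` on a cycle of length `n`. -/
def Precedes (n r k : ℕ) : Prop := r < n ∧ (r + 1 = k ∨ k = 0 ∧ r + 1 = n)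

section

variable {V : Type*} {u : ℕ → V} {n : ℕ}

theorem EnumeratesCycle.eq_succ_iff (h : EnumeratesCycle u n) {i k : ℕ} (hi : i < n) (hk : k < n) :
    u k = u (i + 1) ↔ Precedes n i k := by
  rcases Nat.lt_or_ge (i + 1) n with h1 | h1
  · constructor
    · intro h2
      exact ⟨hi, Or.inl (h.inj k hk _ h1 h2).symm⟩
    · rintro ⟨-, rfl | h2⟩
      · rfl
      · omega
  · rw [show i + 1 = n by omega, h.wrap]
    constructor
    · intro h2
      exact ⟨hi, Or.inr ⟨h.inj k hk 0 (by omega) h2, by omega⟩⟩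
    · rintro ⟨-, rfl | h2⟩
      · omega
      · rw [h2.1]

theorem EnumeratesCycle.mem_iff (h : EnumeratesCycle u n) {i r k : ℕ} (hi : i < n) (hk : k < n)
    (hr : Precedes n r k) : u k ∈ s(u i, u (i + 1)) ↔ i = k ∨ i = r := by
  rw [Sym2.mem_iff, h.eq_succ_iff hi hk]
  refine or_congr ⟨fun h1 => (h.inj k hk i hi h1).symm, fun h1 => by rw [h1]⟩ ?_
  unfold Precedes at *
  omega

theorem EnumeratesCycle.edge_inj (h : EnumeratesCycle u n) {i j : ℕ} (hi : i < n) (hj : j < n)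
    (he : s(u i, u (i + 1)) = s(u j, u (j + 1))) : i = j := by
  have h3 := h.three_le
  rcases Sym2.eq_iff.1 he with h1 | h1
  · exact h.inj i hi j hj h1.1
  · have h2 := (h.eq_succ_iff hj hi).1 h1.1
    have h4 := (h.eq_succ_iff hi hj).1 h1.2.symm
    unfold Precedes at *
    omega

variable [DecidableEq V]

/-- The degree of `x` in the edge set `F`, modulo two. -/
def incidence (F : Finset (Sym2 V)) (x : V) : ZMod 2 := ∑ e ∈ F, if x ∈ e then 1 else 0

theorem SimpleGraph.Walk.IsCycle.incidence_edges {G : SimpleGraph V} {v : V} {w : G.Walk v v}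
    (hw : w.IsCycle) (x : V) : incidence w.edges.toFinset x = 0 := by
  have h := (hw.isTrail.even_countP_edges_iff x).2 fun h => absurd rfl h
  rw [incidence, Finset.sum_boole, ZMod.natCast_eq_zero_iff_even]
  convert h using 1
  rw [List.countP_eq_length_filter, ← List.toFinset_card_of_nodup (hw.edges_nodup.filter _),
    List.toFinset_filter]
  simp

/-- The edges `u i u (i + 1)` with `x i = 1`, together with the chords `g c` for `c ∈ S`. -/
def edgesOf (u : ℕ → V) (n : ℕ) (g : Fin 4 → Sym2 V) (x : ℕ → ZMod 2) (S : Finset (Fin 4)) :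
    Finset (Sym2 V) :=
  (((Finset.range n).filter fun i => x i = 1).image fun i => s(u i, u (i + 1))) ∪ S.image g

theorem ite_eq_self_of_zmod (x : ZMod 2) : (if x = 1 then 1 else 0) = x := by
  revert x; decide

theorem EnumeratesCycle.sum_edgesOf (h : EnumeratesCycle u n) {g : Fin 4 → Sym2 V} {x : ℕ → ZMod 2}
    {S : Finset (Fin 4)} (hS : Set.InjOn g S) (hg : ∀ c ∈ S, ∀ i < n, g c ≠ s(u i, u (i + 1)))
    {M : Type*} [AddCommMonoid M] (φ : Sym2 V → M) :
    ∑ e ∈ edgesOf u n g x S, φ e =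
      (∑ i ∈ (Finset.range n).filter fun i => x i = 1, φ s(u i, u (i + 1))) + ∑ c ∈ S, φ (g c) := by
  rw [edgesOf, Finset.sum_union, Finset.sum_image, Finset.sum_image hS]
  · intro i hi j hj hij
    simp only [Finset.coe_filter, Finset.mem_range, Set.mem_ofPred_eq] at hi hj
    exact h.edge_inj hi.1 hj.1 hij
  · rw [Finset.disjoint_left]
    intro e he he'
    obtain ⟨i, hi, rfl⟩ := Finset.mem_image.1 he
    obtain ⟨c, hc, hci⟩ := Finset.mem_image.1 he'
    exact hg c hc i (Finset.mem_range.1 (Finset.mem_filter.1 hi).1) hci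

theorem EnumeratesCycle.incidence_edgesOf (h : EnumeratesCycle u n) {g : Fin 4 → Sym2 V}
    {x : ℕ → ZMod 2} {S : Finset (Fin 4)} {p q : Fin 4 → ℕ} (hS : Set.InjOn g S)
    (hg : ∀ c ∈ S, ∀ i < n, g c ≠ s(u i, u (i + 1)))
    (hgpq : ∀ c ∈ S, g c = s(u (p c), u (q c)) ∧ p c < n ∧ q c < n ∧ p c ≠ q c)
    {r k : ℕ} (hk : k < n) (hr : Precedes n r k) :
    incidence (edgesOf u n g x S) (u k) =
      x r + x k + ∑ c ∈ S, ((if p c = k then 1 else 0) + if q c = k then 1 else 0) := by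
  have h3 := h.three_le
  rw [incidence, h.sum_edgesOf hS hg]
  congr 1
  · rw [Finset.sum_filter]
    calc _ = ∑ i ∈ Finset.range n, ((if i = r then x i else 0) + if i = k then x i else 0) := by
          refine Finset.sum_congr rfl fun i hi => ?_
          rw [if_congr (h.mem_iff (Finset.mem_range.1 hi) hk hr) rfl rfl]
          have hx := ite_eq_self_of_zmod (x i)
          have hrk : r ≠ k := by unfold Precedes at hr; omega
          by_cases h1 : i = k
          · subst h1; simp [hrk.symm, hx]
          · by_cases h2 : i = r
            · subst h2; simp [h1, hx]
            · simp [h1, h2]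
      _ = x r + x k := by
          rw [Finset.sum_add_distrib, Finset.sum_ite_eq', Finset.sum_ite_eq',
            if_pos (Finset.mem_range.2 hr.1), if_pos (Finset.mem_range.2 hk)]
  · refine Finset.sum_congr rfl fun c hc => ?_
    obtain ⟨h1, hp, hq, hne⟩ := hgpq c hc
    have h2 : u k ∈ g c ↔ p c = k ∨ q c = k := by
      rw [h1, Sym2.mem_iff]
      refine or_congr ⟨fun h2 => (h.inj _ hk _ hp h2).symm, fun h2 => by rw [h2]⟩
        ⟨fun h2 => (h.inj _ hk _ hq h2).symm, fun h2 => by rw [h2]⟩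
    rw [if_congr h2 rfl rfl]
    by_cases h4 : p c = k
    · have : q c ≠ k := fun h5 => hne (h4.trans h5.symm)
      simp [h4, this]
    · simp [h4]

/-- A nonempty even subset of the edges of a cycle contains all of them. -/
theorem SimpleGraph.Walk.IsCycle.subset_of_incidence {G : SimpleGraph V} {v : V} {w : G.Walk v v}
    (hw : w.IsCycle) {F : Finset (Sym2 V)} (hF : F ⊆ w.edges.toFinset) (hne : F.Nonempty)
    (hinc : ∀ y, incidence F y = 0) : w.edges.toFinset ⊆ F := by
  have h := hw.enumeratesCycle
  let x : ℕ → ZMod 2 := fun i => if s(w.getVert i, w.getVert (i + 1)) ∈ F then 1 else 0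
  have hx : ∀ i, x i = 1 ↔ s(w.getVert i, w.getVert (i + 1)) ∈ F := fun i => by simp [x]
  have hmem : ∀ e ∈ w.edges.toFinset, ∃ i < w.length, s(w.getVert i, w.getVert (i + 1)) = e := by
    intro e he
    induction e with | _ a b => exact (w.mk_mem_edges_iff_exists).1 (List.mem_toFinset.1 he)
  have hFx : F = edgesOf w.getVert w.length (fun _ => s(v, v)) x ∅ := by
    ext e
    simp only [edgesOf, Finset.image_empty, Finset.union_empty, Finset.mem_image, Finset.mem_filter,
      Finset.mem_range, hx]
    constructor
    · intro he
      obtain ⟨i, hi, rfl⟩ := hmem e (hF he)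
      exact ⟨i, ⟨hi, he⟩, rfl⟩
    · rintro ⟨i, ⟨-, hi⟩, rfl⟩
      exact hi
  have hconst : ∀ k < w.length, x k = x 0 := by
    intro k hk
    induction k with
    | zero => rfl
    | succ k ih =>
      have h1 := hinc (w.getVert (k + 1))
      rw [hFx, h.incidence_edgesOf (p := fun _ => 0) (q := fun _ => 0) (by simp) (by simp) (by simp)
        hk ⟨by omega, Or.inl rfl⟩, Finset.sum_empty, add_zero, CharTwo.add_eq_zero] at h1
      rw [← h1, ih (by omega)]
  obtain ⟨e, he⟩ := hne
  obtain ⟨i, hi, rfl⟩ := hmem e (hF he)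
  intro e' he'
  obtain ⟨j, hj, rfl⟩ := hmem e' he'
  rw [← hx, hconst j hj, ← hconst i hi, hx]
  exact he

end

theorem side_add_side {p q : Fin 4 → ℕ} {S : Finset (Fin 4)} {n r k : ℕ} (t : Bool)
    (hpq : ∀ c, p c < n ∧ q c < n) (hr : Precedes n r k) :
    side p q S t r + side p q S t k =
      ∑ c ∈ S, ((if p c = k then 1 else 0) + if q c = k then 1 else 0) := by
  have key : ∀ a < n, ((if r < a then 1 else 0) + if k < a then 1 else 0 : ZMod 2) =
      (if a = k then 1 else 0) + if k = 0 then 1 else 0 := by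
    intro a ha
    rcases hr with ⟨hr, rfl | ⟨rfl, rfl⟩⟩
    · rcases lt_trichotomy (r + 1) a with h | h | h
      · simp [h, (Nat.lt_succ_self r).trans h, h.ne']; decide
      · simp [← h]
      · simp [h.ne, show ¬ r < a by omega, show ¬ r + 1 < a by omega]
    · rcases Nat.eq_zero_or_pos a with h | h
      · subst h; simp; decide
      · simp [h, h.ne', show ¬ r < a by omega]
  rw [side, side, add_add_add_comm, CharTwo.add_self_eq_zero, zero_add, ← Finset.sum_add_distrib]
  refine Finset.sum_congr rfl fun c _ => ?_
  rw [add_add_add_comm, key _ (hpq c).1, key _ (hpq c).2, add_add_add_comm,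
    CharTwo.add_self_eq_zero, add_zero]

theorem exists_side_eq {p q : Fin 4 → ℕ} {S : Finset (Fin 4)} {n : ℕ} {x : ℕ → ZMod 2}
    (hpq : ∀ c, p c < n ∧ q c < n)
    (hx : ∀ k, k + 1 < n → x k + x (k + 1) =
      ∑ c ∈ S, ((if p c = k + 1 then 1 else 0) + if q c = k + 1 then 1 else 0)) :
    ∃ t, ∀ k < n, x k = side p q S t k := by
  have hbit : ∀ y : ZMod 2, ∃ t, bit2 t = y := by decide
  obtain ⟨t, ht⟩ := hbit (x 0 + ∑ c ∈ S, ((if 0 < p c then 1 else 0) + if 0 < q c then 1 else 0))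
  refine ⟨t, fun k hk => ?_⟩
  induction k with
  | zero => rw [side, ht, add_assoc, CharTwo.add_self_eq_zero, add_zero]
  | succ k ih =>
    have h1 := hx k hk
    rw [← side_add_side t hpq ⟨by omega, Or.inl rfl⟩, ih (by omega)] at h1
    exact add_left_cancel h1

/-- At most four unordered pairs of terms of a surjective sequence can be listed with sorted
positions. -/
theorem exists_sorted_chords {V : Type*} {u : ℕ → V} {n : ℕ} (hu : ∀ y, ∃ i < n, u i = y) (y₀ : V)
    {E : Set (Sym2 V)} (hfin : E.Finite) (hE : E.ncard ≤ 4) :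
    ∃ p q : Fin 4 → ℕ, Monotone p ∧ (∀ c, p c ≤ q c) ∧ (∀ c, p c < n ∧ q c < n) ∧
      ∀ e ∈ E, ∃ c, s(u (p c), u (q c)) = e := by
  have := hfin.fintype
  obtain ⟨f⟩ : Nonempty (E ↪ Fin 4) := Function.Embedding.nonempty_of_card_le (by
    rwa [Fintype.card_fin, ← Set.toFinset_card, ← Set.ncard_eq_toFinset_card'])
  let g : Fin 4 → Sym2 V := Function.extend f Subtype.val fun _ => s(y₀, y₀)
  have hg : ∀ c, ∃ a b, a ≤ b ∧ b < n ∧ s(u a, u b) = g c := by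
    intro c
    induction g c with | _ y z
    obtain ⟨a, ha, rfl⟩ := hu y
    obtain ⟨b, hb, rfl⟩ := hu z
    rcases le_total a b with h | h
    · exact ⟨a, b, h, hb, rfl⟩
    · exact ⟨b, a, h, ha, Sym2.eq_swap⟩
  choose p q hpq hq hg using hg
  refine ⟨p ∘ Tuple.sort p, q ∘ Tuple.sort p, Tuple.monotone_sort p, fun c => hpq _,
    fun c => ⟨(hpq _).trans_lt (hq _), hq _⟩, fun e he => ⟨(Tuple.sort p).symm (f ⟨e, he⟩), ?_⟩⟩
  simp only [Function.comp_apply, Equiv.apply_symm_apply, hg]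
  exact f.injective.extend_apply _ _ ⟨e, he⟩

theorem SimpleGraph.Walk.IsHamiltonianCycle.not_pancyclic {V : Type*} [Fintype V] [DecidableEq V]
    {G : SimpleGraph V} (hn : 25 ≤ Fintype.card V) {v : V} {w : G.Walk v v}
    (hw : w.IsHamiltonianCycle) (hc : (G.edgeSet \ {e | e ∈ w.edges}).ncard ≤ 4) :
    ¬ Pancyclic G := by
  intro hpan
  have hlen := hw.length_eq
  have h := hw.isCycle.enumeratesCycle
  have hsurj : ∀ y, ∃ i < w.length, w.getVert i = y := by
    intro y
    obtain ⟨i, hi, hin⟩ := w.mem_support_iff_exists_getVert.1 (hw.mem_support y)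
    have := h.three_le
    rcases hin.lt_or_eq with h1 | rfl
    · exact ⟨i, h1, hi⟩
    · exact ⟨0, by omega, by rw [← h.wrap, hi]⟩
  have hedge : ∀ e, e ∈ w.edges ↔ ∃ i < w.length, s(w.getVert i, w.getVert (i + 1)) = e := by
    intro e
    induction e with | _ a b => exact w.mk_mem_edges_iff_exists
  obtain ⟨p, q, hp, hpq, hlt, hcov⟩ := exists_sorted_chords hsurj v (Set.toFinite _) hc
  generalize hgdef : (fun c => s(w.getVert (p c), w.getVert (q c))) = g at hcov
  have hg : ∀ c, g c = s(w.getVert (p c), w.getVert (q c)) := fun c => hgdef ▸ rfl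
  replace hcov : ∀ e ∈ G.edgeSet \ {e | e ∈ w.edges}, ∃ c, g c = e := fun e he => by
    simpa only [hg] using hcov e he
  obtain ⟨k, hk3, hkn, hk⟩ := exists_missing_card (hlen ▸ hn) hp hpq
  obtain ⟨a, C, hC, hCk⟩ := hpan k hk3 (hlen ▸ hkn)
  set F := C.edges.toFinset with hF
  have hFG : ∀ e ∈ F, e ∈ G.edgeSet := fun e he => C.edges_subset_edgeSet (List.mem_toFinset.1 he)
  obtain ⟨S, -, hinj, himg⟩ := Finset.exists_subset_injOn_image_eq_of_surjOn (f := g) Set.univ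
    (F.filter fun e => e ∉ w.edges) (fun e he => by
      obtain ⟨he, hew⟩ := Finset.mem_filter.1 he
      obtain ⟨c, hc⟩ := hcov e ⟨hFG e he, hew⟩
      exact ⟨c, trivial, hc⟩)
  have hgS : ∀ c ∈ S, g c ∈ F ∧ g c ∉ w.edges := fun c hc =>
    Finset.mem_filter.1 (himg ▸ Finset.mem_image_of_mem g hc)
  have hgw : ∀ c ∈ S, ∀ i < w.length, g c ≠ s(w.getVert i, w.getVert (i + 1)) :=
    fun c hc i hi he => (hgS c hc).2 ((hedge _).2 ⟨i, hi, he.symm⟩)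
  have hgpq : ∀ c ∈ S, g c = s(w.getVert (p c), w.getVert (q c)) ∧ p c < w.length ∧
      q c < w.length ∧ p c ≠ q c := fun c hc => by
    refine ⟨hg c, (hlt c).1, (hlt c).2, fun hne => ?_⟩
    have := hFG _ (hgS c hc).1
    rw [hg, hne, SimpleGraph.mem_edgeSet] at this
    exact G.loopless.irrefl _ this
  let x : ℕ → ZMod 2 := fun i => if s(w.getVert i, w.getVert (i + 1)) ∈ F then 1 else 0
  have hx : ∀ i, x i = 1 ↔ s(w.getVert i, w.getVert (i + 1)) ∈ F := fun i => by simp [x]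
  have hFx : F = edgesOf w.getVert w.length g x S := by
    ext e
    simp only [edgesOf, himg, Finset.mem_union, Finset.mem_image, Finset.mem_filter,
      Finset.mem_range, hx]
    constructor
    · intro he
      by_cases hew : e ∈ w.edges
      · obtain ⟨i, hi, rfl⟩ := (hedge e).1 hew
        exact Or.inl ⟨i, ⟨hi, he⟩, rfl⟩
      · exact Or.inr ⟨he, hew⟩
    · rintro (⟨i, ⟨-, hi⟩, rfl⟩ | he)
      · exact hi
      · exact he.1
  obtain ⟨t, ht⟩ := exists_side_eq (x := x) (S := S) hlt fun k hk => by
    have h1 := hC.incidence_edges (w.getVert (k + 1))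
    rw [← hF, hFx, h.incidence_edgesOf hinj hgw hgpq hk ⟨by omega, Or.inl rfl⟩,
      CharTwo.add_eq_zero] at h1
    exact h1
  have hcard : S.card + ((Finset.range w.length).filter fun i => side p q S t i = 1).card = k := by
    rw [← hCk, ← C.length_edges, ← List.toFinset_card_of_nodup hC.edges_nodup, ← hF,
      Finset.card_eq_sum_ones F, hFx, h.sum_edgesOf hinj hgw, Finset.sum_const, Finset.sum_const,
      smul_eq_mul, smul_eq_mul, mul_one, mul_one, add_comm]
    congr 2
    exact Finset.filter_congr fun i hi => by rw [ht i (Finset.mem_range.1 hi)]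
  have hone : ∀ t, side p q ∅ t = fun _ => bit2 t := fun t => by
    funext i; rw [side, Finset.sum_empty, add_zero]
  refine hk S t ?_ ?_ hcard
  · by_contra! hcon
    rw [hcon.1, (Bool.eq_false_iff).2 hcon.2, hone] at hcard
    simp [bit2] at hcard
    omega
  · intro S' hS' t' hne hle
    have h3 := h.three_le
    have hsub : edgesOf w.getVert w.length g (side p q S' t') S' ⊆ F := by
      intro e he
      rw [hFx]
      rcases Finset.mem_union.1 he with he | he
      · obtain ⟨i, hi, rfl⟩ := Finset.mem_image.1 he
        obtain ⟨hi, hi1⟩ := Finset.mem_filter.1 hi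
        refine Finset.mem_union_left _ (Finset.mem_image_of_mem _ (Finset.mem_filter.2 ⟨hi, ?_⟩))
        rw [ht i (Finset.mem_range.1 hi)]
        exact hle i (Finset.mem_range.1 hi) hi1
      · exact Finset.mem_union_right _ (Finset.image_subset_image hS' he)
    have hnonempty : (edgesOf w.getVert w.length g (side p q S' t') S').Nonempty := by
      by_cases hS0 : S'.Nonempty
      · exact (hS0.image g).mono Finset.subset_union_right
      · rw [Finset.not_nonempty_iff_eq_empty] at hS0
        have ht' := hne.resolve_left (by simp [hS0])
        refine ⟨_, Finset.mem_union_left _ (Finset.mem_image_of_mem _ (Finset.mem_filter.2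
          ⟨Finset.mem_range.2 (show 0 < w.length by omega), ?_⟩))⟩
        rw [hS0, hone, ht']
        rfl
    have hFeq := hC.subset_of_incidence hsub hnonempty fun y => by
      obtain ⟨i, hi, rfl⟩ := hsurj y
      obtain ⟨r, hr⟩ : ∃ r, Precedes w.length r i := by
        rcases i with _ | i
        · exact ⟨w.length - 1, by omega, Or.inr ⟨rfl, by omega⟩⟩
        · exact ⟨i, by omega, Or.inl rfl⟩
      rw [h.incidence_edgesOf (hinj.mono hS') (fun c hc => hgw c (hS' hc))
        (fun c hc => hgpq c (hS' hc)) hi hr, side_add_side t' hlt hr, CharTwo.add_self_eq_zero]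
    have hSS : S' = S := by
      refine hS'.antisymm fun c hc => ?_
      rcases Finset.mem_union.1 (hFeq (hgS c hc).1) with he | he
      · obtain ⟨i, hi, hic⟩ := Finset.mem_image.1 he
        exact absurd hic.symm (hgw c hc i (Finset.mem_range.1 (Finset.mem_filter.1 hi).1))
      · obtain ⟨d, hd, hdc⟩ := Finset.mem_image.1 he
        rwa [← hinj (hS' hd) hc hdc]
    subst hSS
    refine ⟨rfl, ?_⟩
    have h0 : side p q S' t' 0 = 1 ↔ side p q S' t 0 = 1 := by
      refine ⟨hle 0 (by omega), fun h1 => ?_⟩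
      rw [← ht 0 (by omega), hx] at h1
      rcases Finset.mem_union.1 (hFeq h1) with he | he
      · obtain ⟨i, hi, hic⟩ := Finset.mem_image.1 he
        obtain ⟨hi, hi1⟩ := Finset.mem_filter.1 hi
        rwa [h.edge_inj (Finset.mem_range.1 hi) (by omega) hic] at hi1
      · obtain ⟨d, hd, hdc⟩ := Finset.mem_image.1 he
        exact absurd hdc (hgw d hd 0 (by omega))
    have hz : ∀ a b : ZMod 2, (a = 1 ↔ b = 1) → a = b := by decide
    exact bit2_injective (add_right_cancel (hz _ _ h0))

/-- No Hamiltonian graph on `n ≥ 25` vertices consisting of a Hamiltonian cycle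
plus at most 4 chords is pancyclic. -/
theorem stmt_6 {n : ℕ} (hn : 25 ≤ n) (G : SimpleGraph (Fin n))
    (v : Fin n) (w : G.Walk v v) (hw : w.IsHamiltonianCycle)
    (hc : (G.edgeSet \ {e | e ∈ w.edges}).ncard ≤ 4) :
    ¬ Pancyclic G :=
  hw.not_pancyclic (by simpa using hn) hc
end

section
/- Let G be a pancyclic graph whose Hamiltonian cycle has vertices v_1, ..., v_n in order (indices mod n). Suppose (1) G has more than one cycle of length 4, (2) there are chords p = v_i v_j and q = v_{i+1} v_{j+1}, and (3) the only chord of G crossing p is q and the only chord crossing q is p. Then G − p (G with edge p deleted) is pancyclic; in particular G is not a minimal pancyclic graph. -/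
open SimpleGraph

/-- Starting at `i` and going around the Hamiltonian cycle `0,1,…,n-1` of `ZMod n`
clockwise, one meets `k`, then `j`, then `l` (all distinct from `i` and each other):
the chords `i j` and `k l` cross. -/
def Crosses {n : ℕ} (i k j l : ZMod n) : Prop :=
  0 < (k - i).val ∧ (k - i).val < (j - i).val ∧ (j - i).val < (l - i).val

/-- The chords `{x, y}` and `{k, l}` of the standard Hamiltonian cycle cross. -/
def ChordCross {n : ℕ} (x y k l : ZMod n) : Prop :=
  Crosses x k y l ∨ Crosses x l y k

/-- `{x, y}` is a chord of `G` relative to the standard Hamiltonian cycle on `ZMod n`: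
it is an edge of `G` not lying on the cycle. -/
def IsChord {n : ℕ} (G : SimpleGraph (ZMod n)) (x y : ZMod n) : Prop :=
  G.Adj x y ∧ ∀ i : ZMod n, s(x, y) ≠ s(i, i + 1)

namespace SimpleGraph

variable {V : Type*} {G : SimpleGraph V}

namespace Walk

theorem IsPath.eq_of_mem_of_mem {u v w x : V} {p : G.Walk u v} {q : G.Walk v w}
    (h : (p.append q).IsPath) (hp : x ∈ p.support) (hq : x ∈ q.support) : x = v := by
  by_contra hx
  exact h.ne_of_mem_support_of_append hx hp hq rfl

theorem IsPath.append_of_forall {u v w : V} {p : G.Walk u v} {q : G.Walk v w}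
    (hp : p.IsPath) (hq : q.IsPath) (h : ∀ x ∈ p.support, x ∈ q.support → x = v) :
    (p.append q).IsPath := by
  have hq' := hq.support_nodup
  rw [← cons_tail_support, List.nodup_cons] at hq'
  rw [isPath_def, support_append, List.nodup_append']
  refine ⟨hp.support_nodup, hq'.2, fun x hx hxq ↦ hq'.1 ?_⟩
  exact h x hx (List.mem_of_mem_tail hxq) ▸ hxq

/-- Closing up a path of length at least two by an edge between its ends gives a cycle. -/
theorem IsPath.hasCycleLength {u v : V} {p : G.Walk u v} (hp : p.IsPath) (h : G.Adj v u)
    (hl : 2 ≤ p.length) : HasCycleLength G (p.length + 1) := by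
  refine ⟨v, cons h p, (cons_isCycle_iff p h).2 ⟨hp, fun he ↦ ?_⟩, by simp⟩
  have := hp.length_eq_one_of_mem_edges (Sym2.eq_swap ▸ he)
  omega

theorem IsPath.exists_eq_toWalk_of_mem_edges {u v : V} {p : G.Walk u v} (hp : p.IsPath)
    (h : s(u, v) ∈ p.edges) : ∃ h : G.Adj u v, p = h.toWalk :=
  ⟨_, hp.eq_adj_toWalk_of_mem_edges h⟩

/-- The other arc of a cycle through a given edge is a path joining the ends of that edge. -/
theorem IsCycle.exists_isPath_of_mem_edges {u a d : V} {w : G.Walk u u} (hw : w.IsCycle)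
    (he : s(a, d) ∈ w.edges) :
    ∃ p : G.Walk d a, p.IsPath ∧ p.length + 1 = w.length ∧ s(a, d) ∉ p.edges ∧
      ∀ e, e ∈ w.edges ↔ e = s(a, d) ∨ e ∈ p.edges := by
  classical
  have ha := w.fst_mem_support_of_mem_edges he
  have hperm := (w.rotate_edges a ha).perm
  have hc := hw.rotate ha
  have hlen : (w.rotate a ha).length = w.length := by
    rw [← length_edges, ← length_edges, hperm.length_eq]
  have he' : s(a, d) ∈ (w.rotate a ha).edges := hperm.mem_iff.2 he
  simp only [← hlen, ← hperm.mem_iff]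
  generalize w.rotate a ha = c at hc he'
  have had : a ≠ d := (c.adj_of_mem_edges he').ne
  obtain ⟨q, r, rfl⟩ := mem_support_iff_exists_append.1 (c.snd_mem_support_of_mem_edges he')
  have hq : q.IsPath := hc.isPath_of_append_left fun h ↦ had h.eq.symm
  have hr : r.IsPath := hc.isPath_of_append_right fun h ↦ had h.eq
  have hdis : List.Disjoint q.edges r.edges := (isTrail_append q r).1 hc.isTrail |>.2.2
  rw [edges_append, List.mem_append] at he'
  rcases he' with h | h
  · obtain ⟨_, rfl⟩ := hq.exists_eq_toWalk_of_mem_edges h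
    exact ⟨r, hr, by simp [add_comm], hdis h, by simp⟩
  · obtain ⟨_, rfl⟩ := hr.exists_eq_toWalk_of_mem_edges (Sym2.eq_swap ▸ h)
    refine ⟨q.reverse, hq.reverse, by simp, by simpa using hdis.symm h, ?_⟩
    simp [or_comm, Sym2.eq_swap (a := d)]

theorem mem_edges_of_cut {S : Set V} {a b c d : V}
    (hcut : ∀ x ∈ S, ∀ y ∉ S, G.Adj x y →
      (x = c ∧ y = a) ∨ (x = c ∧ y = b) ∨ (x = d ∧ y = b))
    {x y : V} (p : G.Walk x y) (hx : x ∈ S) (hy : y ∉ S) :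
    s(c, a) ∈ p.edges ∨ s(c, b) ∈ p.edges ∨ s(d, b) ∈ p.edges := by
  obtain ⟨e, he, h1, h2⟩ := p.exists_boundary_dart S hx hy
  have hm : s(e.fst, e.snd) ∈ p.edges := List.mem_map.2 ⟨e, he, rfl⟩
  rcases hcut _ h1 _ h2 e.adj with ⟨h, h'⟩ | ⟨h, h'⟩ | ⟨h, h'⟩ <;> rw [h, h'] at hm <;> simp [hm]

/-- If the edge cut at `S` is the path `a`, `c`, `b`, `d`, then a path from `d` to `a` is either
this path or can be replaced by a cycle with one more edge. -/
theorem IsPath.hasCycleLength_or_of_cut {S : Set V} {a b c d : V}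
    (hc : c ∈ S) (hd : d ∈ S) (ha : a ∉ S) (hb : b ∉ S) (hcd : c ≠ d) (hab : a ≠ b)
    (hca : G.Adj c a) (hcb : G.Adj c b) (hdb : G.Adj d b)
    (hcut : ∀ x ∈ S, ∀ y ∉ S, G.Adj x y →
      (x = c ∧ y = a) ∨ (x = c ∧ y = b) ∨ (x = d ∧ y = b))
    {p : G.Walk d a} (hp : p.IsPath) :
    HasCycleLength G (p.length + 1) ∨
      p.length = 3 ∧ ∀ e, e ∈ p.edges ↔ e = s(d, b) ∨ e = s(b, c) ∨ e = s(c, a) := by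
  have hne {x y : V} (hx : x ∈ S) (hy : y ∉ S) : x ≠ y := fun h ↦ hy (h ▸ hx)
  have pos {x y : V} (q : G.Walk x y) (h : x ≠ y) : 0 < q.length :=
    Nat.pos_of_ne_zero fun h0 ↦ h (eq_of_length_eq_zero h0)
  have fst {x y u v : V} {q : G.Walk x y} (h : s(u, v) ∈ q.edges) : u ∈ q.support :=
    q.fst_mem_support_of_mem_edges h
  have snd {x y u v : V} {q : G.Walk x y} (h : s(u, v) ∈ q.edges) : v ∈ q.support :=
    q.snd_mem_support_of_mem_edges h
  by_cases hbp : b ∈ p.support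
  swap
  · have hm : s(c, a) ∈ p.edges := by
      have := mem_edges_of_cut hcut p hd ha
      grind
    obtain ⟨q, r, hq, hr, rfl⟩ := hp.mem_support_iff_exists_append.1 (fst hm)
    have haq : a ∉ q.support := fun h ↦
      (hne hc ha).symm (hp.eq_of_mem_of_mem h r.end_mem_support)
    have hrl : r.length = 1 := hr.length_eq_one_of_mem_edges <| by
      rw [edges_append, List.mem_append] at hm
      exact hm.resolve_left fun h ↦ haq (snd h)
    left
    have := (hq.concat (fun h ↦ hbp (by simp [h])) hcb).hasCycleLength hdb.symm
      (by have := pos q hcd.symm; simp; omega)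
    simpa [hrl] using this
  by_cases hcp : c ∈ p.support
  swap
  · have hm : s(d, b) ∈ p.edges := by
      have := mem_edges_of_cut hcut p hd ha
      grind
    obtain ⟨q, r, hq, hr, rfl⟩ := hp.mem_support_iff_exists_append.1 (snd hm)
    have hdr : d ∉ r.support := fun h ↦
      (hne hd hb) (hp.eq_of_mem_of_mem q.start_mem_support h)
    have hql : q.length = 1 := hq.length_eq_one_of_mem_edges <| by
      rw [edges_append, List.mem_append] at hm
      exact hm.resolve_right fun h ↦ hdr (fst h)
    left
    have := (hr.concat (fun h ↦ hcp (by simp [h])) hca.symm).hasCycleLength hcb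
      (by have := pos r hab.symm; simp; omega)
    simpa [hql, add_comm] using this
  obtain ⟨q, r, hq, hr, rfl⟩ := hp.mem_support_iff_exists_append.1 hbp
  rw [mem_support_append_iff] at hcp
  rcases hcp with hcq | hcr
  · obtain ⟨q₁, q₂, hq₁, hq₂, rfl⟩ := hq.mem_support_iff_exists_append.1 hcq
    have hdis : ∀ x ∈ q₁.support, x ∉ r.support := fun x h h' ↦ by
      obtain rfl := hp.eq_of_mem_of_mem (by simp [h]) h'
      exact hne hc hb (hq.eq_of_mem_of_mem h q₂.end_mem_support).symm
    have haq : a ∉ q₂.support := fun h ↦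
      hab (hp.eq_of_mem_of_mem (by simp [h]) r.end_mem_support)
    have hdq : d ∉ q₂.support := fun h ↦
      hcd (hq.eq_of_mem_of_mem q₁.start_mem_support h).symm
    have hl : q₂.length = 1 := hq₂.length_eq_one_of_mem_edges <| by
      rcases mem_edges_of_cut hcut q₂ hc hb with h | h | h
      exacts [(haq (snd h)).elim, h, (hdq (fst h)).elim]
    left
    have hpath : (q₁.append (cons hca r.reverse)).IsPath := by
      have hcr : c ∉ r.support := hdis c q₁.end_mem_support
      refine hq₁.append_of_forall (hr.reverse.cons (by simpa using hcr)) fun x hx hx' ↦ ?_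
      simp only [support_cons, support_reverse, List.mem_cons, List.mem_reverse] at hx'
      exact hx'.resolve_right (hdis x hx)
    have := hpath.hasCycleLength hdb.symm
      (by have := pos r hab.symm; have := pos q₁ hcd.symm; simp; omega)
    simp only [length_append, length_cons, length_reverse, hl] at this ⊢
    convert this using 1
    omega
  · obtain ⟨r₁, r₂, hr₁, hr₂, rfl⟩ := hr.mem_support_iff_exists_append.1 hcr
    have hcq : c ∉ q.support := fun h ↦ hne hc hb (hp.eq_of_mem_of_mem h (by simp))
    have har : a ∉ r₁.support := fun h ↦
      hne hc ha (hr.eq_of_mem_of_mem h r₂.end_mem_support).symm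
    have hdr₁ : d ∉ r₁.support := fun h ↦
      hne hd hb (hp.eq_of_mem_of_mem q.start_mem_support (by simp [h]))
    have hdr₂ : d ∉ r₂.support := fun h ↦
      hne hd hb (hp.eq_of_mem_of_mem q.start_mem_support (by simp [h]))
    have hbr : b ∉ r₂.support := fun h ↦
      hne hc hb (hr.eq_of_mem_of_mem r₁.start_mem_support h).symm
    obtain ⟨_, rfl⟩ := hq.exists_eq_toWalk_of_mem_edges <| by
      rcases mem_edges_of_cut hcut q hd hb with h | h | h
      exacts [(hcq (fst h)).elim, (hcq (fst h)).elim, h]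
    obtain ⟨_, rfl⟩ := hr₁.exists_eq_toWalk_of_mem_edges <| by
      rcases mem_edges_of_cut hcut r₁.reverse hc hb with h | h | h <;>
        rw [edges_reverse, List.mem_reverse] at h
      exacts [(har (snd h)).elim, Sym2.eq_swap ▸ h, (hdr₁ (fst h)).elim]
    obtain ⟨_, rfl⟩ := hr₂.exists_eq_toWalk_of_mem_edges <| by
      rcases mem_edges_of_cut hcut r₂ hc ha with h | h | h
      exacts [h, (hbr (snd h)).elim, (hdr₂ (fst h)).elim]
    right
    simp

end Walk

end SimpleGraph

theorem ZMod.val_add_one_sub {n : ℕ} [NeZero n] (hn : n ≠ 1) (i x : ZMod n) :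
    (x + 1 - i).val = if (x - i).val + 1 = n then 0 else (x - i).val + 1 := by
  have hlt := (x - i).val_lt
  rw [add_sub_right_comm, ZMod.val_add, ZMod.val_one'' hn]
  split_ifs with h
  · rw [h, Nat.mod_self]
  · exact Nat.mod_eq_of_lt (by omega)

theorem ZMod.val_sub_add_one {n : ℕ} [NeZero n] (hn : n ≠ 1) (i x : ZMod n) :
    (x - (i + 1)).val = if (x - i).val = 0 then n - 1 else (x - i).val - 1 := by
  have h := ZMod.val_add_one_sub hn (i + 1) x
  rw [add_sub_add_right_eq_sub] at h
  have := (x - (i + 1)).val_lt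
  split_ifs at h ⊢ <;> omega

/-- The arc of the standard Hamiltonian cycle from `i + 1` to `j`. -/
def arc {n : ℕ} (i j : ZMod n) : Set (ZMod n) :=
  {x | 0 < (x - i).val ∧ (x - i).val ≤ (j - i).val}

theorem IsChord.val_sub_bounds {n : ℕ} [NeZero n] {G : SimpleGraph (ZMod n)} {i j : ZMod n}
    (hp : IsChord G i j) : 1 < (j - i).val ∧ (j - i).val + 1 < n := by
  have h0 : (j - i).val ≠ 0 := by
    rw [Ne, ZMod.val_eq_zero, sub_eq_zero]
    exact hp.1.ne.symm
  have hlt := (j - i).val_lt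
  have h1 := ZMod.val_add_one_sub (by omega) i i
  have h2 := ZMod.val_add_one_sub (by omega) i j
  rw [sub_self, ZMod.val_zero] at h1
  have h3 : (i + 1 - i).val ≠ (j - i).val := fun h ↦ by
    have := sub_left_injective (ZMod.val_injective n h)
    exact hp.2 i (by rw [this])
  have h4 : (j + 1 - i).val ≠ 0 := fun h ↦ by
    rw [ZMod.val_eq_zero, sub_eq_zero] at h
    exact hp.2 j (by rw [h, Sym2.eq_swap])
  split_ifs at h1 h2 <;> omega

theorem IsChord.arc_facts {n : ℕ} [NeZero n] {G : SimpleGraph (ZMod n)} {i j : ZMod n}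
    (hp : IsChord G i j) :
    i + 1 ∈ arc i j ∧ j ∈ arc i j ∧ i ∉ arc i j ∧ j + 1 ∉ arc i j ∧
      i + 1 ≠ j ∧ i ≠ j + 1 := by
  have hJ := hp.val_sub_bounds
  have h1 := ZMod.val_add_one_sub (by omega) i i
  have h2 := ZMod.val_add_one_sub (by omega) i j
  rw [sub_self, ZMod.val_zero, if_neg (by omega)] at h1
  rw [if_neg (by omega)] at h2
  simp only [arc, Set.mem_ofPred_eq, h1, h2, sub_self, ZMod.val_zero]
  refine ⟨by omega, by omega, by omega, by omega, ?_, ?_⟩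
  · rintro h
    rw [h] at h1
    omega
  · intro h
    rw [← h, sub_self, ZMod.val_zero] at h2
    omega

theorem eq_of_mem_arc_of_adj {n : ℕ} [NeZero n] {G : SimpleGraph (ZMod n)} {i j : ZMod n}
    (hp : IsChord G i j)
    (honly : ∀ x y : ZMod n, IsChord G x y →
      (ChordCross i j x y → s(x, y) = s(i + 1, j + 1)) ∧
      (ChordCross (i + 1) (j + 1) x y → s(x, y) = s(i, j)))
    {x y : ZMod n} (hx : x ∈ arc i j) (hy : y ∉ arc i j) (hxy : G.Adj x y) :
    (x = i + 1 ∧ y = i) ∨ (x = i + 1 ∧ y = j + 1) ∨ (x = j ∧ y = j + 1) ∨ (x = j ∧ y = i) := by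
  have hJ := hp.val_sub_bounds
  have hn : n ≠ 1 := by omega
  have inj {u v : ZMod n} (h : (u - i).val = (v - i).val) : u = v :=
    sub_left_injective (ZMod.val_injective n h)
  have hii : (i - i).val = 0 := by simp
  have hi := ZMod.val_add_one_sub hn i i
  have hj := ZMod.val_add_one_sub hn i j
  have hxlt := (x - i).val_lt
  have hylt := (y - i).val_lt
  have hx' := ZMod.val_sub_add_one hn i x
  have hy' := ZMod.val_sub_add_one hn i y
  have hJ' : (j + 1 - (i + 1)).val = (j - i).val := by rw [add_sub_add_right_eq_sub]
  rw [if_neg (by omega)] at hi hj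
  simp only [arc, Set.mem_ofPred_eq] at hx hy
  have hxi : x = i + 1 ↔ (x - i).val = 1 := ⟨by rintro rfl; omega, fun h ↦ inj (by omega)⟩
  have hxj : x = j ↔ (x - i).val = (j - i).val := ⟨by rintro rfl; rfl, inj⟩
  have hyi : y = i ↔ (y - i).val = 0 := ⟨by rintro rfl; exact hii, fun h ↦ inj (by omega)⟩
  have hyj : y = j + 1 ↔ (y - i).val = (j - i).val + 1 :=
    ⟨by rintro rfl; omega, fun h ↦ inj (by omega)⟩
  by_cases hch : IsChord G x y
  · obtain ⟨h1, h2⟩ := honly x y hch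
    by_cases hA : x ≠ j ∧ y ≠ i
    · rw [Ne, Ne, hxj, hyi] at hA
      have := h1 (.inl ⟨by omega, by omega, by omega⟩)
      rcases Sym2.eq_iff.1 this with h | h
      · exact .inr (.inl h)
      · rw [h.1] at hx
        omega
    by_cases hB : x ≠ i + 1 ∧ y ≠ j + 1
    · rw [Ne, Ne, hxi, hyj] at hB
      have hcr : Crosses (i + 1) x (j + 1) y := by
        refine ⟨?_, ?_, ?_⟩ <;> split_ifs at hx' hy' <;> omega
      rcases Sym2.eq_iff.1 (h2 (.inl hcr)) with h | h
      · rw [h.1] at hx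
        omega
      · exact .inr (.inr (.inr h))
    rw [Ne, Ne, hxj, hyi] at hA
    rw [Ne, Ne, hxi, hyj] at hB
    rw [hxi, hxj, hyi, hyj]
    omega
  · have ⟨t, ht⟩ : ∃ t, s(x, y) = s(t, t + 1) := by
      by_contra! h
      exact hch ⟨hxy, h⟩
    have ht' := ZMod.val_add_one_sub hn i t
    rw [hxi, hxj, hyi, hyj]
    rcases Sym2.eq_iff.1 ht with ⟨rfl, rfl⟩ | ⟨rfl, rfl⟩ <;> split_ifs at ht' <;> omega

theorem SimpleGraph.Iso.pancyclic {V W : Type*} [Fintype V] [Fintype W] {G : SimpleGraph V}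
    {H : SimpleGraph W} (f : G ≃g H) (h : Pancyclic G) : Pancyclic H := by
  intro k h3 hk
  obtain ⟨v, w, hw, rfl⟩ := h k h3 (by rwa [Fintype.card_congr f.toEquiv])
  exact ⟨f v, w.map f.toHom, hw.map f.injective, by simp⟩

theorem m_le_ncard_edgeSet {V : Type*} [Fintype V] {G : SimpleGraph V} (h : Pancyclic G) :
    m (Fintype.card V) ≤ G.edgeSet.ncard := by
  let f := SimpleGraph.Iso.map (Fintype.equivFin V) G
  refine Nat.sInf_le ⟨_, f.pancyclic h, ?_⟩
  exact (Nat.card_congr f.mapEdgeSet).symm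

/-- If a pancyclic graph `G` (with the standard Hamiltonian cycle on `ZMod n`) has
more than one cycle of length 4, chords `p = v_i v_j` and `q = v_{i+1} v_{j+1}`,
and the only chord crossing `p` is `q` and the only chord crossing `q` is `p`,
then `G - p` is pancyclic; in particular `G` is not minimal pancyclic. -/
theorem stmt_7 {n : ℕ} [NeZero n] (G : SimpleGraph (ZMod n))
    (hH : ∀ i : ZMod n, G.Adj i (i + 1)) (hG : Pancyclic G)
    (i j : ZMod n) (hp : IsChord G i j) (hq : IsChord G (i + 1) (j + 1))
    (h4 : 1 < ({s ∈ cycleSets G |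
        ∃ (v : ZMod n) (c : G.Walk v v), c.IsCycle ∧ c.length = 4 ∧
          s = {e | e ∈ c.edges}}).ncard)
    (honly : ∀ x y : ZMod n, IsChord G x y →
      (ChordCross i j x y → s(x, y) = s(i + 1, j + 1)) ∧
      (ChordCross (i + 1) (j + 1) x y → s(x, y) = s(i, j))) :
    Pancyclic (G.deleteEdges {s(i, j)}) ∧ m n < G.edgeSet.ncard := by
  obtain ⟨hc, hd, ha, hb, hcd, hab⟩ := hp.arc_facts
  set H := G.deleteEdges {s(i, j)} with hHdef
  have adjH {x y : ZMod n} (h : G.Adj x y) (h' : s(x, y) ≠ s(i, j)) : H.Adj x y := by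
    simpa [hHdef, deleteEdges_adj, h] using h'
  have hca : H.Adj (i + 1) i := adjH (hH i).symm fun h ↦ by
    grind
  have hcb : H.Adj (i + 1) (j + 1) := adjH hq.1 fun h ↦ by
    grind
  have hdb : H.Adj j (j + 1) := adjH (hH j) fun h ↦ by
    grind
  have hcut : ∀ x ∈ arc i j, ∀ y ∉ arc i j, H.Adj x y →
      (x = i + 1 ∧ y = i) ∨ (x = i + 1 ∧ y = j + 1) ∨ (x = j ∧ y = j + 1) := by
    intro x hx y hy hxy
    rw [hHdef, deleteEdges_adj] at hxy
    have := eq_of_mem_arc_of_adj hp honly hx hy hxy.1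
    grind
  have toH {l : List (Sym2 (ZMod n))} (h : ∀ ⦃e⦄, e ∈ l → e ∈ G.edgeSet) (h' : s(i, j) ∉ l) :
      ∀ e ∈ l, e ∈ H.edgeSet := by
    intro e he
    rw [hHdef, edgeSet_deleteEdges]
    exact ⟨h he, fun h ↦ h' (h ▸ he)⟩
  have key {v : ZMod n} {w : G.Walk v v} (hw : w.IsCycle) : HasCycleLength H w.length ∨
      w.length = 4 ∧
        {e | e ∈ w.edges} = {s(i, j), s(j, j + 1), s(j + 1, i + 1), s(i + 1, i)} := by
    by_cases he : s(i, j) ∈ w.edges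
    · obtain ⟨p, hpp, hl, hpe, hedges⟩ := hw.exists_isPath_of_mem_edges he
      have hpH := toH p.edges_subset_edgeSet hpe
      rcases (hpp.transfer hpH).hasCycleLength_or_of_cut hc hd ha hb hcd hab
        hca hcb hdb hcut with h | ⟨h, h'⟩
      · left
        simpa [hl] using h
      · right
        simp only [Walk.length_transfer, Walk.edges_transfer] at h h'
        refine ⟨by omega, Set.ext fun e ↦ ?_⟩
        simp [hedges, h']
    · left
      have hwH := toH w.edges_subset_edgeSet he
      exact ⟨v, w.transfer H hwH, hw.transfer hwH, by simp⟩
  have hpan : Pancyclic H := by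
    intro k h3 hk
    by_cases h : k = 4
    · obtain ⟨s, ⟨-, v, w, hw, hl, rfl⟩, hne⟩ := Set.exists_ne_of_one_lt_ncard h4
        {s(i, j), s(j, j + 1), s(j + 1, i + 1), s(i + 1, i)}
      exact h ▸ hl ▸ (key hw).resolve_right fun h ↦ hne h.2
    · obtain ⟨v, w, hw, rfl⟩ := hG k h3 hk
      exact (key hw).resolve_right fun h' ↦ h h'.1
  refine ⟨hpan, ?_⟩
  have hm := m_le_ncard_edgeSet hpan
  rw [ZMod.card] at hm
  refine hm.trans_lt (Set.ncard_lt_ncard ?_)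
  rw [hHdef, edgeSet_deleteEdges]
  exact Set.sdiff_singleton_ssubset.2 hp.1
end

section
/- The graph on 14 vertices consisting of a Hamiltonian cycle v_1 v_2 ... v_14 together with the three chords v_1v_13, v_3v_14, v_9v_14 is pancyclic. -/
open SimpleGraph

/-- The standard Hamiltonian cycle `0,1,2,…,n-1` on `ZMod n`. -/
def stdCycle (n : ℕ) : SimpleGraph (ZMod n) :=
  SimpleGraph.fromRel (fun i j => j = i + 1)

theorem hasCycleLength_of_isChain {V : Type*} {G : SimpleGraph V} {k : ℕ} (l : List V)
    (hne : l ≠ []) (hchain : l.IsChain G.Adj) (hnodup : l.Nodup) (hlen : l.length = k)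
    (hk : 3 ≤ k) (hclose : G.Adj (l.getLast hne) (l.head hne)) : HasCycleLength G k := by
  have hlength : (Walk.ofSupport l hne hchain).length + 1 = k := by
    rw [← Walk.length_support, Walk.support_ofSupport, hlen]
  have hpath : (Walk.ofSupport l hne hchain).IsPath := by
    rwa [Walk.isPath_def, Walk.support_ofSupport]
  refine ⟨_, .cons hclose (.ofSupport l hne hchain), ?_, hlength⟩
  refine (Walk.cons_isCycle_iff _ _).2 ⟨hpath, fun hmem ↦ ?_⟩
  have := hpath.length_eq_one_of_mem_edges (Sym2.eq_swap ▸ hmem)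
  omega

theorem stdCycle_adj {n : ℕ} {i j : ZMod n} :
    (stdCycle n).Adj i j ↔ i ≠ j ∧ (j = i + 1 ∨ i = j + 1) :=
  fromRel_adj ..

instance (n : ℕ) : DecidableRel (stdCycle n).Adj :=
  fun _ _ ↦ decidable_of_iff' _ stdCycle_adj

/-- The Hamiltonian cycle `v_1 v_2 ⋯ v_14` (here `v_i` is `i - 1 : ZMod 14`)
together with the chords `v_1v_13, v_3v_14, v_9v_14` is pancyclic. -/
theorem stmt_13 :
    Pancyclic (stdCycle 14 ⊔ SimpleGraph.fromEdgeSet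
      {s((0 : ZMod 14), 12), s(2, 13), s(8, 13)}) := by
  intro k hk hk'
  rw [ZMod.card] at hk'
  have cycle (a : ZMod 14) (l : List (ZMod 14)) (h :
      (a :: l).IsChain (stdCycle 14 ⊔ SimpleGraph.fromEdgeSet
        {s((0 : ZMod 14), 12), s(2, 13), s(8, 13)}).Adj ∧ (a :: l).Nodup ∧
      (a :: l).length = k ∧ (stdCycle 14 ⊔ SimpleGraph.fromEdgeSet
        {s((0 : ZMod 14), 12), s(2, 13), s(8, 13)}).Adj ((a :: l).getLast (by simp)) a) :=
    hasCycleLength_of_isChain (a :: l) (by simp) h.1 h.2.1 h.2.2.1 hk h.2.2.2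
  interval_cases k
  · exact cycle 13 [0, 12] (by decide)
  · exact cycle 13 [0, 1, 2] (by decide)
  · exact cycle 13 [2, 1, 0, 12] (by decide)
  · exact cycle 13 [8, 9, 10, 11, 12] (by decide)
  · exact cycle 13 [0, 12, 11, 10, 9, 8] (by decide)
  · exact cycle 13 [2, 3, 4, 5, 6, 7, 8] (by decide)
  · exact cycle 13 [2, 1, 0, 12, 11, 10, 9, 8] (by decide)
  · exact cycle 13 [0, 1, 2, 3, 4, 5, 6, 7, 8] (by decide)
  · exact cycle 13 [8, 7, 6, 5, 4, 3, 2, 1, 0, 12] (by decide)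
  · exact cycle 13 [2, 3, 4, 5, 6, 7, 8, 9, 10, 11, 12] (by decide)
  · exact cycle 13 [0, 12, 11, 10, 9, 8, 7, 6, 5, 4, 3, 2] (by decide)
  · exact cycle 13 [0, 1, 2, 3, 4, 5, 6, 7, 8, 9, 10, 11, 12] (by decide)
end
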